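/- arXiv:1610.07195 — 5 statements merged into one kernel-verified Lean document; each statement's English description precedes it below -/
import Mathlib

section
/- Let S ⊂ ℤ^n be a finite set whose ℝ-span is all of ℝ^n, let σ^∨ = {Σ_{s∈S} t_s·s : t_s ∈ ℝ_{≥0}} be the (full-dimensional) rational polyhedral cone generated by S, and let P = σ^∨ ∩ ℤ^n. Let X = Hom(P, ℂ) be the set of monoid homomorphisms (P, +) → (ℂ, ·) with the topology of pointwise convergence, on which the group Λ = Hom(ℤ^n, circle) of group homomorphisms acts by (λ·φ)(p) = λ(p)·φ(p). Let X_{≥0} = {φ ∈ X : φ(P) ⊆ ℝ_{≥0}} and X° = {φ ∈ X : φ(p) ≠ 0 for all p ∈ P}. Then there exists a continuous map μ : X → ℝ^n such that: (i) the image of μ is σ^∨; (ii) μ(λ·φ) = μ(φ) for all λ ∈ Λ, φ ∈ X; (iii) μ restricted to X_{≥0} is a homeomorphism onto σ^∨, with inverse s₀ : σ^∨ → X_{≥0}; and (iv) the map Λ × Int(σ^∨) → X, (λ, a) ↦ λ·s₀(a), is a homeomorphism onto X°. That is, the affine toric variety Spec ℂ[σ^∨ ∩ ℤ^n] admits a momentum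 map with image the defining cone σ^∨. -/
/-- The cone `σ^∨ ⊆ ℝ^n` generated by a finite set `S ⊂ ℤ^n` of integral vectors:
all combinations `Σ_{s ∈ S} t_s·s` with `t_s ∈ ℝ_{≥0}`. -/
def coneGen (n : ℕ) (S : Finset (Fin n → ℤ)) : Set (Fin n → ℝ) :=
  {x | ∃ c : (Fin n → ℤ) → ℝ, (∀ v, 0 ≤ c v) ∧
    x = ∑ v ∈ S, c v • (fun i => (v i : ℝ))}

/-- The monoid `P = σ^∨ ∩ ℤ^n` of lattice points of the cone generated by `S`. -/
def conePoints (n : ℕ) (S : Finset (Fin n → ℤ)) : AddSubmonoid (Fin n → ℤ) where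
  carrier := {m | (fun i => (m i : ℝ)) ∈ coneGen n S}
  zero_mem' := ⟨0, fun _ => le_rfl, by funext i; simp⟩
  add_mem' := by
    rintro a b ⟨c, hc, hx⟩ ⟨d, hd, hy⟩
    refine ⟨c + d, fun v => add_nonneg (hc v) (hd v), ?_⟩
    have h : (fun i => ((a + b) i : ℝ)) = (fun i => (a i : ℝ)) + (fun i => (b i : ℝ)) := by
      funext i
      simp only [Pi.add_apply]
      push_cast
      rfl
    rw [h, hx, hy, ← Finset.sum_add_distrib]
    simp [add_smul]

/-- The topology of pointwise convergence on additive characters. -/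
instance addCharPointwiseTopology (A M : Type*) [AddMonoid A] [Monoid M]
    [TopologicalSpace M] : TopologicalSpace (AddChar A M) :=
  TopologicalSpace.induced (fun f => (f : A → M)) Pi.topologicalSpace

open Filter Topology

section ToricSet

variable {ι V : Type*} [Fintype ι] [NormedAddCommGroup V] [NormedSpace ℝ V]

/-- The nonnegative points `x` of `ℝ^ι` satisfying every binomial equation `x ^ a = x ^ b` with
nonnegative real exponents such that `∑ i, a i • w i = ∑ i, b i • w i`. -/
def nonnegToricSet (w : ι → V) : Set (ι → ℝ) :=
  {x | 0 ≤ x ∧ ∀ a b : ι → ℝ, 0 ≤ a → 0 ≤ b → ∑ i, a i • w i = ∑ i, b i • w i →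
    ∏ i, x i ^ a i = ∏ i, x i ^ b i}

theorem continuous_prod_rpow {a : ι → ℝ} (ha : 0 ≤ a) :
    Continuous fun x : ι → ℝ => ∏ i, x i ^ a i :=
  continuous_finsetProd _ fun i _ => (Real.continuous_rpow_const (ha i)).comp (continuous_apply i)

theorem isClosed_nonnegToricSet (w : ι → V) : IsClosed (nonnegToricSet w) := by
  have h : nonnegToricSet w = Set.Ici 0 ∩ ⋂ (a : ι → ℝ) (b : ι → ℝ) (_ : 0 ≤ a) (_ : 0 ≤ b)
      (_ : ∑ i, a i • w i = ∑ i, b i • w i), {x | ∏ i, x i ^ a i = ∏ i, x i ^ b i} := by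
    ext x
    simp [nonnegToricSet]
  rw [h]
  refine isClosed_Ici.inter ?_
  refine isClosed_iInter fun a => isClosed_iInter fun b => isClosed_iInter fun ha =>
    isClosed_iInter fun hb => isClosed_iInter fun _ => ?_
  exact isClosed_eq (continuous_prod_rpow ha) (continuous_prod_rpow hb)

theorem rpow_self_pos {t : ℝ} (ht : 0 ≤ t) : 0 < t ^ t := by
  rcases ht.eq_or_lt with rfl | h
  · simp
  · positivity

theorem pos_of_mem_nonnegToricSet {w : ι → V} {x y : ι → ℝ} (hx : x ∈ nonnegToricSet w)
    (hy : 0 ≤ y) (h : ∑ i, x i • w i = ∑ i, y i • w i) {i : ι} (hi : 0 < y i) : 0 < x i := by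
  have h1 : 0 < ∏ i, x i ^ y i := by
    rw [← hx.2 x y hx.1 hy h]
    exact Finset.prod_pos fun i _ => rpow_self_pos (hx.1 i)
  refine (hx.1 i).lt_of_ne fun h0 => h1.ne' (Finset.prod_eq_zero (Finset.mem_univ i) ?_)
  rw [← h0]
  exact Real.zero_rpow hi.ne'

theorem sum_mul_log_eq_of_mem_nonnegToricSet {w : ι → V} {x y : ι → ℝ}
    (hx : x ∈ nonnegToricSet w) (hy : 0 ≤ y)
    (h : ∑ i, x i • w i = ∑ i, y i • w i) :
    ∑ i, x i * Real.log (x i) = ∑ i, y i * Real.log (x i) := by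
  have hpow : ∀ a : ι → ℝ, (∀ i, 0 < a i → 0 < x i) → 0 ≤ a →
      ∏ i, x i ^ a i = Real.exp (∑ i, a i * Real.log (x i)) := by
    intro a ha ha0
    rw [Real.exp_sum]
    refine Finset.prod_congr rfl fun i _ => ?_
    rcases (ha0 i).eq_or_lt with h0 | h0
    · simp [← h0]
    · rw [Real.rpow_def_of_pos (ha i h0), mul_comm]
  have := hx.2 x y hx.1 hy h
  rwa [hpow x (fun _ => id) hx.1, hpow y (fun i hi => pos_of_mem_nonnegToricSet hx hy h hi) hy,
    Real.exp_eq_exp] at this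

theorem injOn_nonnegToricSet (w : ι → V) :
    Set.InjOn (fun x : ι → ℝ => ∑ i, x i • w i) (nonnegToricSet w) := by
  intro x hx y hy h
  have hxy : ∀ i, 0 < x i → 0 < y i := fun i hi =>
    pos_of_mem_nonnegToricSet hy hx.1 h.symm hi
  have hyx : ∀ i, 0 < y i → 0 < x i := fun i hi => pos_of_mem_nonnegToricSet hx hy.1 h hi
  have h1 := sum_mul_log_eq_of_mem_nonnegToricSet hx hy.1 h
  have h2 := sum_mul_log_eq_of_mem_nonnegToricSet hy hx.1 h.symm
  have h3 : ∑ i, (x i - y i) * (Real.log (x i) - Real.log (y i)) = 0 := by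
    simp only [mul_sub, sub_mul, Finset.sum_sub_distrib]
    linarith
  have hlog : ∀ s t : ℝ, 0 < s → s < t → 0 < (s - t) * (Real.log s - Real.log t) :=
    fun s t hs hst => mul_pos_of_neg_of_neg (by linarith) (by linarith [Real.log_lt_log hs hst])
  have hterm : ∀ i, x i ≠ y i → 0 < (x i - y i) * (Real.log (x i) - Real.log (y i)) := by
    intro i hne
    rcases (hx.1 i).eq_or_lt with h0 | h0
    · refine absurd ?_ hne
      by_contra hne'
      have : 0 < y i := (hy.1 i).lt_of_ne fun h' => hne' (h0.symm.trans h')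
      exact (hyx i this).ne h0
    · rcases lt_or_gt_of_ne hne with hlt | hlt
      · exact hlog _ _ h0 hlt
      · linarith [hlog _ _ (hxy i h0) hlt]
  funext i
  by_contra hne
  have hnonneg : ∀ i ∈ Finset.univ, 0 ≤ (x i - y i) * (Real.log (x i) - Real.log (y i)) := by
    intro j _
    by_cases hj : x j = y j
    · simp [hj]
    · exact (hterm j hj).le
  exact (hterm i hne).ne' ((Finset.sum_eq_zero_iff_of_nonneg hnonneg).1 h3 i (Finset.mem_univ i))

theorem log_mul_sub_le {s t : ℝ} (hs : 0 < s) (ht : 0 ≤ t) :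
    Real.log s * (t - s) ≤ (t * Real.log t - t) - (s * Real.log s - s) := by
  rcases ht.eq_or_lt with rfl | ht
  · simp; linarith
  · have h := Real.add_one_le_exp (Real.log s - Real.log t)
    rw [Real.exp_sub, Real.exp_log hs, Real.exp_log ht, le_div_iff₀ ht] at h
    nlinarith

theorem prod_rpow_le_of_isMinOn {w : ι → V} {c a b : ι → ℝ} {F : Set (ι → ℝ)}
    (hF : ∀ y, y ∈ F ↔ 0 ≤ y ∧ ∑ i, y i • w i = ∑ i, c i • w i) (hc : 0 ≤ c)
    (hmin : IsMinOn (fun y : ι → ℝ => ∑ i, (y i * Real.log (y i) - y i)) F c)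
    (ha : 0 ≤ a) (hb : 0 ≤ b) (hab : ∑ i, a i • w i = ∑ i, b i • w i) :
    ∏ i, c i ^ b i ≤ ∏ i, c i ^ a i := by
  by_cases hsupp : ∀ i, 0 < b i → 0 < c i
  swap
  · push Not at hsupp
    obtain ⟨i, hi, hci⟩ := hsupp
    rw [Finset.prod_eq_zero (Finset.mem_univ i)]
    · exact Finset.prod_nonneg fun i _ => Real.rpow_nonneg (hc i) _
    · rw [le_antisymm hci (hc i)]
      exact Real.zero_rpow hi.ne'
  let d : ℝ → ι → ℝ := fun ε i => c i + ε * (a i - b i)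
  have hd : Continuous d := by fun_prop
  have hd0 : Tendsto d (𝓝[>] 0) (𝓝 c) := by
    have := hd.tendsto 0
    simp only [d, zero_mul, add_zero] at this
    exact this.mono_left nhdsWithin_le_nhds
  have hpos : ∀ i, ∀ᶠ ε in 𝓝[>] (0 : ℝ), 0 < d ε i ∨ (d ε i = 0 ∧ c i = 0 ∧ a i = 0 ∧ b i = 0) := by
    intro i
    rcases (hc i).eq_or_lt with h0 | h0
    · have hbi : b i = 0 := le_antisymm (not_lt.1 fun h => (hsupp i h).ne h0) (hb i)
      filter_upwards [self_mem_nhdsWithin] with ε hε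
      rcases (ha i).eq_or_lt with h1 | h1
      · right
        simp only [Pi.zero_apply] at h0 h1
        simp [d, ← h0, ← h1, hbi]
      · left
        simp only [d, ← h0, hbi, Pi.zero_apply, sub_zero, zero_add]
        exact mul_pos hε h1
    · filter_upwards [((continuous_apply i).tendsto c |>.comp hd0).eventually (lt_mem_nhds h0)]
        with ε hε
      exact Or.inl hε
  have hle : ∀ᶠ ε in 𝓝[>] (0 : ℝ), ∏ i, d ε i ^ b i ≤ ∏ i, d ε i ^ a i := by
    filter_upwards [eventually_all.2 hpos, self_mem_nhdsWithin] with ε hpos (hε : 0 < ε)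
    have hpow : ∀ i, d ε i ^ a i = Real.exp (Real.log (d ε i) * a i) ∧
        d ε i ^ b i = Real.exp (Real.log (d ε i) * b i) := by
      intro i
      rcases hpos i with h | ⟨-, -, h1, h2⟩
      · exact ⟨Real.rpow_def_of_pos h _, Real.rpow_def_of_pos h _⟩
      · simp [h1, h2]
    simp only [(hpow _).1, (hpow _).2, ← Real.exp_sum, Real.exp_le_exp]
    have hdF : d ε ∈ F := by
      refine (hF _).2 ⟨fun i => ?_, ?_⟩
      · rcases hpos i with h | h
        exacts [h.le, h.1.ge]
      · simp only [d, add_smul, sub_smul, mul_smul, smul_sub, Finset.sum_add_distrib,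
          Finset.sum_sub_distrib, ← Finset.smul_sum, hab, sub_self, add_zero]
    have h1 : ∑ i, Real.log (d ε i) * (c i - d ε i) ≤
        ∑ i, (c i * Real.log (c i) - c i) - ∑ i, (d ε i * Real.log (d ε i) - d ε i) := by
      rw [← Finset.sum_sub_distrib]
      refine Finset.sum_le_sum fun i _ => ?_
      rcases hpos i with h | ⟨h1, h2, -, -⟩
      · exact log_mul_sub_le h (hc i)
      · simp [h1, h2]
    have h2 : ∑ i, Real.log (d ε i) * (c i - d ε i) =
        ε * (∑ i, Real.log (d ε i) * b i - ∑ i, Real.log (d ε i) * a i) := by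
      rw [← Finset.sum_sub_distrib, Finset.mul_sum]
      refine Finset.sum_congr rfl fun i _ => ?_
      simp only [d]
      ring
    have h3 := hmin hdF
    simp only [Set.mem_ofPred_eq] at h3
    have h4 : ε * (∑ i, Real.log (d ε i) * b i - ∑ i, Real.log (d ε i) * a i) ≤ 0 := by
      rw [← h2]; linarith
    linarith [nonpos_of_mul_nonpos_right h4 hε]
  exact le_of_tendsto_of_tendsto (((continuous_prod_rpow hb).tendsto c).comp hd0)
    (((continuous_prod_rpow ha).tendsto c).comp hd0) hle

theorem sub_exp_one_le_mul_log_sub {t : ℝ} (ht : 0 ≤ t) :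
    t - Real.exp 1 ≤ t * Real.log t - t := by
  have := log_mul_sub_le (Real.exp_pos 1) ht
  simp only [Real.log_exp] at this
  linarith

theorem exists_mem_nonnegToricSet (w : ι → V) {y : ι → ℝ} (hy : 0 ≤ y) :
    ∃ x ∈ nonnegToricSet w, ∑ i, x i • w i = ∑ i, y i • w i := by
  let F : Set (ι → ℝ) := {x | 0 ≤ x ∧ ∑ i, x i • w i = ∑ i, y i • w i}
  let E : (ι → ℝ) → ℝ := fun x => ∑ i, (x i * Real.log (x i) - x i)
  have hE : Continuous E := continuous_finsetSum _ fun i _ =>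
    (Real.continuous_mul_log.comp (continuous_apply i)).sub (continuous_apply i)
  have hFc : IsClosed F := by
    refine isClosed_Ici.inter (isClosed_eq ?_ continuous_const)
    fun_prop
  let M : ℝ := E y + ∑ _i : ι, Real.exp 1
  have hK : IsCompact (F ∩ {x | E x ≤ E y}) := by
    refine Metric.isCompact_of_isClosed_isBounded
      (hFc.inter (isClosed_le hE continuous_const)) ?_
    refine (Metric.isBounded_Icc (0 : ι → ℝ) (fun _ => M)).subset fun x hx => ⟨hx.1.1, fun i => ?_⟩
    have h1 : ∑ i, (x i - Real.exp 1) ≤ E x :=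
      Finset.sum_le_sum fun i _ => sub_exp_one_le_mul_log_sub (hx.1.1 i)
    rw [Finset.sum_sub_distrib] at h1
    have h2 : x i ≤ ∑ i, x i :=
      Finset.single_le_sum (fun j _ => hx.1.1 j) (Finset.mem_univ i)
    have h3 : E x ≤ E y := hx.2
    simp only [M]
    linarith
  obtain ⟨c, hc, hmin⟩ := hK.exists_isMinOn ⟨y, ⟨hy, rfl⟩, le_refl (E y)⟩ hE.continuousOn
  have hminF : IsMinOn E F c := by
    intro x hx
    by_cases h : E x ≤ E y
    · exact hmin ⟨hx, h⟩
    · exact hc.2.trans (not_le.1 h).le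
  have hFiff : ∀ x, x ∈ F ↔ 0 ≤ x ∧ ∑ i, x i • w i = ∑ i, c i • w i := by
    intro x
    rw [hc.1.2]
    rfl
  exact ⟨c, ⟨hc.1.1, fun a b ha hb hab => le_antisymm
    (prod_rpow_le_of_isMinOn hFiff hc.1.1 hminF hb ha hab.symm)
    (prod_rpow_le_of_isMinOn hFiff hc.1.1 hminF ha hb hab)⟩, hc.1.2⟩

theorem isBounded_nonnegToricSet_inter (w : ι → V) (R : ℝ) :
    Bornology.IsBounded {x ∈ nonnegToricSet w | ‖∑ i, x i • w i‖ ≤ R} := by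
  by_contra hb
  have hex : ∀ k : ℕ, ∃ x ∈ nonnegToricSet w, ‖∑ i, x i • w i‖ ≤ R ∧ (k : ℝ) < ‖x‖ := by
    intro k
    by_contra! h
    exact hb (isBounded_iff_forall_norm_le.2 ⟨k, fun x hx => h x hx.1 hx.2⟩)
  choose x hx hxR hxk using hex
  have hxpos : ∀ k, 0 < ‖x k‖ := fun k => (Nat.cast_nonneg k).trans_lt (hxk k)
  have hnorm : Tendsto (fun k => ‖x k‖) atTop atTop :=
    tendsto_atTop_mono (fun k => (hxk k).le) tendsto_natCast_atTop_atTop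
  let u : ℕ → ι → ℝ := fun k => ‖x k‖⁻¹ • x k
  have hu : ∀ k, u k ∈ Metric.sphere (0 : ι → ℝ) 1 := by
    intro k
    simp [u, norm_smul, (hxpos k).ne']
  obtain ⟨y, hy1, φ, hφ, hlim⟩ := (isCompact_sphere (0 : ι → ℝ) 1).tendsto_subseq hu
  have hu0 : ∀ k, 0 ≤ u k := fun k => smul_nonneg (inv_nonneg.2 (norm_nonneg _)) (hx k).1
  have hy0 : 0 ≤ y := ge_of_tendsto' hlim fun k => hu0 _
  have hnormφ := hnorm.comp hφ.tendsto_atTop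
  have hmy : ∑ i, y i • w i = 0 := by
    have hcont : Continuous fun z : ι → ℝ => ∑ i, z i • w i := by fun_prop
    refine tendsto_nhds_unique ((hcont.tendsto y).comp hlim) ?_
    refine squeeze_zero_norm (fun k => ?_) (by simpa using hnormφ.inv_tendsto_atTop.mul_const R)
    simp only [u, Function.comp, Pi.smul_apply, smul_assoc, ← Finset.smul_sum, norm_smul, norm_inv,
      norm_norm]
    gcongr
    exact hxR _
  have hysum : 0 < ∑ i, y i := by
    refine (Finset.sum_nonneg fun i _ => hy0 i).lt_of_ne fun h => ?_
    have := (Finset.sum_eq_zero_iff_of_nonneg fun i _ => hy0 i).1 h.symm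
    have hyz : y = 0 := funext fun i => this i (Finset.mem_univ i)
    simp [hyz] at hy1
  have hone : ∀ k, ‖x k‖ ^ (∑ i, y i) * ∏ i, u k i ^ y i = 1 := by
    intro k
    have h := (hx k).2 y 0 hy0 le_rfl (by simpa using hmy)
    simp only [Pi.zero_apply, Real.rpow_zero, Finset.prod_const_one] at h
    rw [← h, Real.rpow_sum_of_pos (hxpos k), ← Finset.prod_mul_distrib]
    refine Finset.prod_congr rfl fun i _ => ?_
    rw [← Real.mul_rpow (norm_nonneg _) (hu0 k i)]
    simp [u, (hxpos k).ne']
  have htop := ((tendsto_rpow_atTop hysum).comp hnormφ).atTop_mul_pos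
    (Finset.prod_pos fun i _ => rpow_self_pos (hy0 i))
    (((continuous_prod_rpow hy0).tendsto y).comp hlim)
  refine not_tendsto_const_atTop (1 : ℝ) (atTop : Filter ℕ) (htop.congr fun k => ?_)
  exact hone (φ k)

theorem isClosedEmbedding_nonnegToricSet (w : ι → V) :
    IsClosedEmbedding fun x : nonnegToricSet w => ∑ i, x.1 i • w i := by
  have hcont : Continuous fun x : ι → ℝ => ∑ i, x i • w i := by fun_prop
  refine .of_continuous_injective_isClosedMap (hcont.comp continuous_subtype_val)
    (injOn_nonnegToricSet w).injective (IsProperMap.isClosedMap ?_)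
  refine isProperMap_iff_isCompact_preimage.2
    ⟨hcont.comp continuous_subtype_val, fun K hK => ?_⟩
  rw [Subtype.isCompact_iff]
  obtain ⟨R, hR⟩ := isBounded_iff_forall_norm_le.1 hK.isBounded
  refine Metric.isCompact_of_isClosed_isBounded ?_
    ((isBounded_nonnegToricSet_inter w R).subset ?_)
  · have : Subtype.val '' ((fun x : nonnegToricSet w => ∑ i, x.1 i • w i) ⁻¹' K) =
        nonnegToricSet w ∩ (fun x : ι → ℝ => ∑ i, x i • w i) ⁻¹' K := by
      ext x
      simp [and_comm]
    rw [this]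
    exact (isClosed_nonnegToricSet w).inter (hK.isClosed.preimage hcont)
  · rintro _ ⟨x, hx, rfl⟩
    exact ⟨x.2, hR _ hx⟩

end ToricSet

section RealExponents

variable {ι : Type*} [Fintype ι] {n : ℕ}

theorem exists_tendsto_rat_linearMap (W : Submodule ℚ ℝ) [Module.Finite ℚ W] :
    ∃ f : ℕ → (W →ₗ[ℚ] ℚ), ∀ v : W, Tendsto (fun k => (f k v : ℝ)) atTop (𝓝 (v : ℝ)) := by
  let B := Module.finBasis ℚ W
  have hr : ∀ t : ℝ, ∃ r : ℕ → ℚ, Tendsto (fun k => (r k : ℝ)) atTop (𝓝 t) := by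
    intro t
    obtain ⟨u, hu, hlim⟩ :=
      mem_closure_iff_seq_limit.1 (Rat.denseRange_cast (𝕜 := ℝ) t)
    choose r hr using hu
    exact ⟨r, by simpa only [hr] using hlim⟩
  choose r hr using fun j => hr (B j)
  refine ⟨fun k => B.constr ℚ fun j => r j k, fun v => ?_⟩
  have h1 := congrArg W.subtype (B.sum_repr v)
  rw [map_sum] at h1
  simp only [map_smul] at h1
  simp only [Rat.smul_def, W.subtype_apply] at h1
  rw [← h1]
  simp only [B.constr_apply_fintype ℚ, Module.Basis.equivFun_apply, smul_eq_mul, Rat.cast_sum,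
    Rat.cast_mul]
  exact tendsto_finsetSum _ fun j _ => (hr j).const_mul _

/-- A real linear relation between integer vectors is a limit of rational ones with zeros at
least where the given relation has them. -/
theorem exists_tendsto_rat_relation (w : ι → Fin n → ℤ) (c : ι → ℝ)
    (h : ∑ i, c i • (fun l => (w i l : ℝ)) = 0) :
    ∃ q : ℕ → ι → ℚ, (∀ i, Tendsto (fun k => (q k i : ℝ)) atTop (𝓝 (c i))) ∧
      (∀ k i, c i = 0 → q k i = 0) ∧ ∀ k l, ∑ i, q k i * (w i l : ℚ) = 0 := by
  let W := Submodule.span ℚ (Set.range c)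
  have : Module.Finite ℚ W := Module.Finite.span_of_finite ℚ (Set.finite_range c)
  obtain ⟨f, hf⟩ := exists_tendsto_rat_linearMap W
  let e : ι → W := fun i => ⟨c i, Submodule.subset_span ⟨i, rfl⟩⟩
  refine ⟨fun k i => f k (e i), fun i => hf (e i), fun k i hi => ?_, fun k l => ?_⟩
  · have : e i = 0 := Subtype.ext hi
    simp [this]
  · have h0 : ∑ i, (w i l : ℚ) • e i = 0 := by
      apply Subtype.ext
      have := congrFun h l
      simpa [e, Rat.smul_def, mul_comm] using this
    have := congrArg (f k) h0
    simpa [mul_comm] using this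

theorem exists_nat_mul_eq_natCast {a : ι → ℚ} (ha : 0 ≤ a) :
    ∃ N : ℕ, 0 < N ∧ ∃ m : ι → ℕ, ∀ i, N * a i = m i := by
  refine ⟨∏ i, (a i).den, Finset.prod_pos fun i _ => (a i).den_pos, ?_⟩
  have : ∀ i, ∃ m : ℕ, ((∏ i, (a i).den : ℕ) : ℚ) * a i = m := by
    intro i
    obtain ⟨d, hd⟩ := Finset.dvd_prod_of_mem (fun i => (a i).den) (Finset.mem_univ i)
    refine ⟨d * (a i).num.toNat, ?_⟩
    rw [hd]
    push_cast
    have h1 : (((a i).num.toNat : ℕ) : ℚ) = (a i).num := by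
      exact_mod_cast Int.toNat_of_nonneg (Rat.num_nonneg.2 (ha i))
    rw [h1, mul_comm ((a i).den : ℚ), mul_assoc, mul_comm ((a i).den : ℚ), Rat.mul_den_eq_num]
  choose m hm using this
  exact ⟨m, hm⟩

theorem AddChar.map_sum_nsmul_eq_prod {A M : Type*} [AddCommMonoid A] [CommMonoid M]
    (ψ : AddChar A M) (m : ι → ℕ) (p : ι → A) :
    ψ (∑ i, m i • p i) = ∏ i, ψ (p i) ^ m i := by
  have h : ∀ s : Finset ι, ψ (∑ i ∈ s, m i • p i) = ∏ i ∈ s, ψ (p i) ^ m i := by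
    intro s
    induction s using Finset.cons_induction with
    | empty => simp
    | cons i s his ih => rw [Finset.sum_cons, Finset.prod_cons, AddChar.map_add_eq_mul,
        AddChar.map_nsmul_eq_pow, ih]
  exact h Finset.univ

variable {P : AddSubmonoid (Fin n → ℤ)} {ψ : AddChar P ℝ}

theorem prod_rpow_eq_of_rat_relation (hψ : ∀ p, 0 ≤ ψ p) (w : ι → P) {a b : ι → ℚ}
    (ha : 0 ≤ a) (hb : 0 ≤ b)
    (h : ∀ l, ∑ i, a i * ((w i : Fin n → ℤ) l : ℚ) = ∑ i, b i * ((w i : Fin n → ℤ) l : ℚ)) :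
    ∏ i, ψ (w i) ^ (a i : ℝ) = ∏ i, ψ (w i) ^ (b i : ℝ) := by
  obtain ⟨N, hN, m, hm⟩ := exists_nat_mul_eq_natCast (ι := ι ⊕ ι) (a := Sum.elim a b)
    (by rintro (i | i); exacts [ha i, hb i])
  have hpow : ∀ (c : ι → ℚ) (d : ι → ℕ), (∀ i, N * c i = d i) →
      (∏ i, ψ (w i) ^ (c i : ℝ)) ^ N = ψ (∑ i, d i • w i) := by
    intro c d hcd
    rw [AddChar.map_sum_nsmul_eq_prod, ← Finset.prod_pow]
    refine Finset.prod_congr rfl fun i _ => ?_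
    rw [← Real.rpow_mul_natCast (hψ _), ← Real.rpow_natCast]
    congr 1
    rw [mul_comm]
    exact_mod_cast hcd i
  have hsum : ∑ i, m (.inl i) • w i = ∑ i, m (.inr i) • w i := by
    apply Subtype.ext
    funext l
    have h1 : ∑ i, (m (.inl i) : ℚ) * ((w i : Fin n → ℤ) l : ℚ) =
        ∑ i, (m (.inr i) : ℚ) * ((w i : Fin n → ℤ) l : ℚ) := by
      simp only [← hm, Sum.elim_inl, Sum.elim_inr, mul_assoc, ← Finset.mul_sum, h]
    simp only [AddSubmonoid.coe_finsetSum, Finset.sum_apply, AddSubmonoidClass.coe_nsmul,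
      nsmul_eq_mul]
    exact_mod_cast h1
  refine (pow_left_inj₀ (Finset.prod_nonneg fun i _ => Real.rpow_nonneg (hψ _) _)
    (Finset.prod_nonneg fun i _ => Real.rpow_nonneg (hψ _) _) hN.ne').1 ?_
  rw [hpow a _ fun i => hm (.inl i), hpow b _ fun i => hm (.inr i), hsum]

/-- A nonnegative character satisfies all binomial equations with real exponents. -/
theorem prod_rpow_eq_of_real_relation (hψ : ∀ p, 0 ≤ ψ p) (w : ι → P) {a b : ι → ℝ}
    (ha : 0 ≤ a) (hb : 0 ≤ b)
    (h : ∑ i, a i • (fun l => ((w i : Fin n → ℤ) l : ℝ)) =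
      ∑ i, b i • (fun l => ((w i : Fin n → ℤ) l : ℝ))) :
    ∏ i, ψ (w i) ^ a i = ∏ i, ψ (w i) ^ b i := by
  obtain ⟨q, hq, hq0, hrel⟩ := exists_tendsto_rat_relation (ι := ι ⊕ ι)
    (Sum.elim (fun i => (w i : Fin n → ℤ)) fun i => -(w i : Fin n → ℤ)) (Sum.elim a b) (by
      have hneg : ∀ i, (fun l => ((-(w i : Fin n → ℤ)) l : ℝ)) =
          -fun l => ((w i : Fin n → ℤ) l : ℝ) := fun i => by ext; simp
      simp only [Fintype.sum_sum_type, Sum.elim_inl, Sum.elim_inr, hneg, smul_neg,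
        Finset.sum_neg_distrib, h, add_neg_cancel])
  have hc0 : ∀ j, 0 ≤ Sum.elim a b j := by
    rintro (i | i)
    exacts [ha i, hb i]
  have hq1 : ∀ᶠ k in atTop, ∀ j, 0 ≤ q k j := by
    refine eventually_all.2 fun j => ?_
    rcases (hc0 j).eq_or_lt with h0 | h0
    · exact .of_forall fun k => (hq0 k j h0.symm).ge
    · filter_upwards [(hq j).eventually (lt_mem_nhds h0)] with k hk
      exact_mod_cast hk.le
  have hlim : ∀ (j : ι ⊕ ι) (t : ℝ),
      Tendsto (fun k => t ^ (q k j : ℝ)) atTop (𝓝 (t ^ Sum.elim a b j)) := by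
    intro j t
    rcases eq_or_ne (Sum.elim a b j) 0 with h0 | h0
    · simp [h0, hq0 _ j h0]
    · exact (Real.continuousAt_const_rpow' h0).tendsto.comp (hq j)
  refine tendsto_nhds_unique_of_eventuallyEq
    (tendsto_finsetProd _ fun i _ => hlim (.inl i) (ψ (w i)))
    (tendsto_finsetProd _ fun i _ => hlim (.inr i) (ψ (w i))) ?_
  filter_upwards [hq1] with k hk
  refine prod_rpow_eq_of_rat_relation hψ w (fun i => hk (.inl i)) (fun i => hk (.inr i)) fun l => ?_
  have := hrel k l
  simp only [Fintype.sum_sum_type, Sum.elim_inl, Sum.elim_inr, Pi.neg_apply, Int.cast_neg, mul_neg,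
    Finset.sum_neg_distrib] at this
  linarith

end RealExponents

section AddCharTopology

variable {A M X : Type*} [AddMonoid A] [Monoid M] [TopologicalSpace M] [TopologicalSpace X]

theorem continuous_addChar_apply (a : A) : Continuous fun ψ : AddChar A M => ψ a :=
  (continuous_apply a).comp continuous_induced_dom

theorem continuous_addChar_of_apply {f : X → AddChar A M}
    (h : ∀ a, Continuous fun x => f x a) : Continuous f :=
  continuous_induced_rng.2 (continuous_pi h)

end AddCharTopology

/-- The phase `z / ‖z‖` of a nonzero complex number. -/
noncomputable def circlePhase (z : ℂ) (hz : z ≠ 0) : Circle :=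
  ⟨z / ‖z‖, by simp [Submonoid.unitSphere, hz]⟩

@[simp]
theorem coe_circlePhase (z : ℂ) (hz : z ≠ 0) : (circlePhase z hz : ℂ) = z / ‖z‖ := rfl

section AngularPart

variable {G : Type*} [AddCommGroup G] {P : AddSubmonoid G} (p q : G → P)
  (hpq : ∀ v, v = (p v : G) - q v)

/-- The angular part of a nowhere vanishing character of `P`, extended to the group `G` by means
of a presentation of the elements of `G` as differences of elements of `P`. -/
noncomputable def angularPart (φ : AddChar P ℂ) (hφ : ∀ r, φ r ≠ 0) : AddChar G Circle where
  toFun v := circlePhase (φ (p v)) (hφ _) / circlePhase (φ (q v)) (hφ _)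
  map_zero_eq_one' := by
    have : p 0 = q 0 := Subtype.ext (sub_eq_zero.1 (hpq 0).symm)
    simp [this]
  map_add_eq_mul' v w := by
    have h : p (v + w) + (q v + q w) = p v + p w + q (v + w) := by
      apply Subtype.ext
      have h1 := hpq v
      have h2 := hpq w
      have h3 := hpq (v + w)
      rw [eq_sub_iff_add_eq] at h1 h2 h3
      simp only [AddSubmonoid.coe_add, ← h1, ← h2, ← h3]
      abel
    have h := congrArg φ h
    simp only [AddChar.map_add_eq_mul] at h
    rw [div_mul_div_comm, div_eq_div_iff_mul_eq_mul]
    apply Circle.ext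
    have h' := congrArg norm h
    simp only [norm_mul] at h'
    simp only [Circle.coe_mul, coe_circlePhase]
    simp only [div_mul_div_comm, h, ← Complex.ofReal_mul, h']

theorem angularPart_eq_div {φ : AddChar P ℂ} (hφ : ∀ r, φ r ≠ 0) (v : G) :
    angularPart p q hpq φ hφ v = circlePhase (φ (p v)) (hφ _) / circlePhase (φ (q v)) (hφ _) :=
  rfl

theorem angularPart_mul_norm {φ : AddChar P ℂ} (hφ : ∀ r, φ r ≠ 0) (r : P) :
    (angularPart p q hpq φ hφ r : ℂ) * ‖φ r‖ = φ r := by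
  have h : r + q r = p r := Subtype.ext (eq_sub_iff_add_eq.1 (hpq r))
  have h1 := hφ r
  have h2 := hφ (q r)
  rw [angularPart_eq_div, Circle.coe_div, coe_circlePhase, coe_circlePhase, ← h,
    AddChar.map_add_eq_mul, norm_mul]
  have h3 : (‖φ r‖ : ℂ) ≠ 0 := by simpa using h1
  have h4 : (‖φ (q r)‖ : ℂ) ≠ 0 := by simpa using h2
  push_cast
  field_simp

theorem angularPart_eq {φ : AddChar P ℂ} (hφ : ∀ r, φ r ≠ 0) (lam : AddChar G Circle)
    (h : ∀ r : P, φ r = lam r * ‖φ r‖) : angularPart p q hpq φ hφ = lam := by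
  have hphase : ∀ r : P, circlePhase (φ r) (hφ r) = lam r := by
    intro r
    apply Circle.ext
    rw [coe_circlePhase, div_eq_iff (by simpa using hφ r)]
    exact h r
  ext1 v
  rw [angularPart_eq_div, hphase, hphase, ← AddChar.map_sub_eq_div, ← hpq]

theorem continuous_angularPart :
    Continuous fun φ : {φ : AddChar P ℂ | ∀ r, φ r ≠ 0} => angularPart p q hpq φ.1 φ.2 := by
  have hphase : ∀ r : P, Continuous fun φ : {φ : AddChar P ℂ | ∀ r, φ r ≠ 0} =>
      circlePhase (φ.1 r) (φ.2 r) := by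
    intro r
    have h := (continuous_addChar_apply (M := ℂ) r).comp
      (continuous_subtype_val (p := fun φ : AddChar P ℂ => ∀ r, φ r ≠ 0))
    refine continuous_induced_rng.2
      (h.div₀ (Complex.continuous_ofReal.comp h.norm) fun φ => ?_)
    simpa using φ.2 r
  exact continuous_addChar_of_apply fun v => (hphase _).div' (hphase _)

end AngularPart

section Cone

variable {n : ℕ} {S : Finset (Fin n → ℤ)}

/-- The generators of the cone, as a family of real vectors. -/
def realGen (S : Finset (Fin n → ℤ)) (s : S) : Fin n → ℝ := fun i => (s.1 i : ℝ)

theorem realGen_def (s : S) : realGen S s = fun i => (s.1 i : ℝ) := rfl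

theorem mem_coneGen_iff {x : Fin n → ℝ} :
    x ∈ coneGen n S ↔ ∃ c : S → ℝ, 0 ≤ c ∧ x = ∑ s, c s • realGen S s := by
  classical
  constructor
  · rintro ⟨c, hc, rfl⟩
    refine ⟨fun s => c s, fun s => hc s, ?_⟩
    exact (Finset.sum_coe_sort S fun v => c v • fun i => (v i : ℝ)).symm
  · rintro ⟨c, hc, rfl⟩
    refine ⟨fun v => if h : v ∈ S then c ⟨v, h⟩ else 0, fun v => ?_, ?_⟩
    · dsimp only
      split_ifs with h
      exacts [hc ⟨v, h⟩, le_rfl]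
    · rw [← Finset.sum_coe_sort S]
      refine Finset.sum_congr rfl fun s _ => ?_
      simp [realGen_def]

theorem mem_conePoints_iff {m : Fin n → ℤ} :
    m ∈ conePoints n S ↔ (fun i => (m i : ℝ)) ∈ coneGen n S := Iff.rfl

/-- The generators of the cone, as elements of the monoid of lattice points. -/
def genPoint (s : S) : conePoints n S :=
  ⟨s, by
    classical
    exact mem_conePoints_iff.2 (mem_coneGen_iff.2
      ⟨Pi.single s 1, Pi.single_nonneg.2 zero_le_one, by
        rw [Finset.sum_eq_single s (fun t _ h => by simp [h]) (by simp)]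
        simp [realGen_def]⟩)⟩

theorem exists_coeff (p : conePoints n S) :
    ∃ c : S → ℝ, 0 ≤ c ∧ (fun i => (p.1 i : ℝ)) = ∑ s, c s • realGen S s :=
  mem_coneGen_iff.1 p.2

/-- Chosen nonnegative coordinates of a lattice point of the cone in terms of the generators. -/
noncomputable def coeff (p : conePoints n S) : S → ℝ := (exists_coeff p).choose

theorem coeff_nonneg (p : conePoints n S) : 0 ≤ coeff p := (exists_coeff p).choose_spec.1

theorem sum_coeff_smul (p : conePoints n S) :
    ∑ s, coeff p s • realGen S s = fun i => (p.1 i : ℝ) := (exists_coeff p).choose_spec.2.symm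

theorem exists_solution (a : coneGen n S) :
    ∃ x ∈ nonnegToricSet (realGen S), ∑ s, x s • realGen S s = a := by
  obtain ⟨c, hc, h⟩ := mem_coneGen_iff.1 a.2
  rw [h]
  exact exists_mem_nonnegToricSet _ hc

/-- The point of the toric set lying over a given point of the cone. -/
noncomputable def coneSection (a : coneGen n S) : nonnegToricSet (realGen S) :=
  ⟨(exists_solution a).choose, (exists_solution a).choose_spec.1⟩

theorem sum_coneSection_smul (a : coneGen n S) :
    ∑ s, (coneSection a).1 s • realGen S s = a := (exists_solution a).choose_spec.2

theorem coneSection_eq {a : coneGen n S} {x : S → ℝ} (hx : x ∈ nonnegToricSet (realGen S))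
    (h : ∑ s, x s • realGen S s = a) : (coneSection a).1 = x :=
  injOn_nonnegToricSet _ (coneSection a).2 hx ((sum_coneSection_smul a).trans h.symm)

theorem continuous_coneSection : Continuous (coneSection (S := S)) := by
  refine (isClosedEmbedding_nonnegToricSet (realGen S)).isInducing.continuous_iff.2 ?_
  exact continuous_subtype_val.congr fun a => (sum_coneSection_smul a).symm

/-- The nonnegative character attached to a point of the cone. -/
noncomputable def coneChar (a : coneGen n S) : AddChar (conePoints n S) ℂ where
  toFun p := ((∏ s, (coneSection a).1 s ^ coeff p s : ℝ) : ℂ)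
  map_zero_eq_one' := by
    rw [Complex.ofReal_eq_one, (coneSection a).2.2 _ 0 (coeff_nonneg 0) le_rfl]
    · simp
    · rw [sum_coeff_smul]
      ext i
      simp
  map_add_eq_mul' p q := by
    rw [← Complex.ofReal_mul, Complex.ofReal_inj, ← Finset.prod_mul_distrib,
      (coneSection a).2.2 _ (coeff p + coeff q) (coeff_nonneg _)
        (add_nonneg (coeff_nonneg p) (coeff_nonneg q))]
    · exact Finset.prod_congr rfl fun s _ =>
        Real.rpow_add_of_nonneg ((coneSection a).2.1 s) (coeff_nonneg p s) (coeff_nonneg q s)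
    · simp only [Pi.add_apply, add_smul, Finset.sum_add_distrib, sum_coeff_smul]
      ext i
      simp

theorem coneChar_apply (a : coneGen n S) (p : conePoints n S) :
    coneChar a p = ((∏ s, (coneSection a).1 s ^ coeff p s : ℝ) : ℂ) := rfl

theorem prod_coneSection_nonneg (a : coneGen n S) (p : conePoints n S) :
    0 ≤ ∏ s, (coneSection a).1 s ^ coeff p s :=
  Finset.prod_nonneg fun s _ => Real.rpow_nonneg ((coneSection a).2.1 s) _

theorem norm_coneChar_apply (a : coneGen n S) (p : conePoints n S) :
    (‖coneChar a p‖ : ℂ) = coneChar a p := by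
  rw [coneChar_apply, Complex.norm_of_nonneg (prod_coneSection_nonneg a p)]

theorem continuous_coneChar : Continuous (coneChar (S := S)) :=
  continuous_addChar_of_apply fun p => Complex.continuous_ofReal.comp
    ((continuous_prod_rpow (coeff_nonneg p)).comp
      (continuous_subtype_val.comp continuous_coneSection))

theorem coneChar_genPoint (a : coneGen n S) (s : S) :
    coneChar a (genPoint s) = (coneSection a).1 s := by
  classical
  rw [coneChar_apply, (coneSection a).2.2 _ (Pi.single s 1) (coeff_nonneg _)
    (Pi.single_nonneg.2 zero_le_one)]
  · rw [Finset.prod_eq_single s (fun t _ h => by simp [h]) (by simp)]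
    simp
  · rw [sum_coeff_smul, Finset.sum_eq_single s (fun t _ h => by simp [h]) (by simp)]
    simp [realGen_def, genPoint]

/-- The momentum map `φ ↦ ∑ s, ‖φ s‖ • s`. -/
noncomputable def momentumMap (φ : AddChar (conePoints n S) ℂ) : Fin n → ℝ :=
  ∑ s : S, ‖φ (genPoint s)‖ • realGen S s

theorem continuous_momentumMap : Continuous (momentumMap (S := S)) :=
  continuous_finsetSum _ fun _ _ => (continuous_addChar_apply _).norm.smul continuous_const

theorem momentumMap_mem (φ : AddChar (conePoints n S) ℂ) : momentumMap φ ∈ coneGen n S :=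
  mem_coneGen_iff.2 ⟨fun s => ‖φ (genPoint s)‖, fun _ => norm_nonneg _, rfl⟩

theorem momentumMap_congr {φ ψ : AddChar (conePoints n S) ℂ} (h : ∀ p, ‖φ p‖ = ‖ψ p‖) :
    momentumMap φ = momentumMap ψ := by
  simp only [momentumMap, h]

theorem momentumMap_coneChar (a : coneGen n S) : momentumMap (coneChar a) = a := by
  rw [← sum_coneSection_smul a]
  refine Finset.sum_congr rfl fun s _ => ?_
  rw [coneChar_genPoint, Complex.norm_of_nonneg ((coneSection a).2.1 s)]

/-- The absolute value of a complex character. -/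
noncomputable def absChar {A : Type*} [AddMonoid A] (φ : AddChar A ℂ) : AddChar A ℝ where
  toFun p := ‖φ p‖
  map_zero_eq_one' := by simp
  map_add_eq_mul' p q := by simp [AddChar.map_add_eq_mul]

theorem absChar_apply {A : Type*} [AddMonoid A] (φ : AddChar A ℂ) (p : A) :
    absChar φ p = ‖φ p‖ := rfl

theorem absChar_nonneg {A : Type*} [AddMonoid A] (φ : AddChar A ℂ) (p : A) :
    0 ≤ absChar φ p := norm_nonneg (φ p)

theorem norm_genPoint_mem_nonnegToricSet (φ : AddChar (conePoints n S) ℂ) :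
    (fun s => ‖φ (genPoint s)‖) ∈ nonnegToricSet (realGen S) :=
  ⟨fun _ => norm_nonneg _, fun _ _ ha hb hab =>
    prod_rpow_eq_of_real_relation (absChar_nonneg φ) genPoint ha hb hab⟩

theorem coneChar_momentumMap_apply (φ : AddChar (conePoints n S) ℂ) (p : conePoints n S) :
    coneChar ⟨momentumMap φ, momentumMap_mem φ⟩ p = ‖φ p‖ := by
  rw [coneChar_apply, Complex.ofReal_inj,
    coneSection_eq (norm_genPoint_mem_nonnegToricSet φ) rfl]
  have h := prod_rpow_eq_of_real_relation (absChar_nonneg φ)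
    (fun o : Option S => o.elim p genPoint) (a := fun o => o.elim 0 (coeff p))
    (b := fun o => o.elim 1 0)
    (by rintro (_ | s); exacts [le_rfl, coeff_nonneg p s])
    (by rintro (_ | s); exacts [zero_le_one, le_rfl])
    (by
      simp only [Fintype.sum_option, Option.elim_none, Option.elim_some, zero_smul, zero_add,
        one_smul, Pi.zero_apply, Finset.sum_const_zero, add_zero]
      exact sum_coeff_smul p)
  simpa [Fintype.prod_option, absChar_apply] using h

theorem surjective_linearCombination_realGen
    (hS : Submodule.span ℝ ((fun v : Fin n → ℤ => fun i => (v i : ℝ)) '' ↑S) = ⊤) :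
    Function.Surjective (Fintype.linearCombination ℝ (realGen S)) := by
  rw [← LinearMap.range_eq_top, Fintype.range_linearCombination, ← hS]
  congr 1
  ext x
  simp [realGen_def]

theorem sum_smul_mem_interior_coneGen
    (hS : Submodule.span ℝ ((fun v : Fin n → ℤ => fun i => (v i : ℝ)) '' ↑S) = ⊤)
    {c : S → ℝ} (hc : ∀ s, 0 < c s) : ∑ s, c s • realGen S s ∈ interior (coneGen n S) := by
  have hopen : IsOpen {c : S → ℝ | ∀ s, 0 < c s} := by
    simp only [Set.ofPred_forall]
    exact isOpen_iInter_of_finite fun s => isOpen_lt continuous_const (continuous_apply s)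
  refine interior_maximal ?_ (LinearMap.isOpenMap_of_finiteDimensional _
    (surjective_linearCombination_realGen hS) _ hopen) ⟨c, hc, rfl⟩
  rintro _ ⟨d, hd, rfl⟩
  exact mem_coneGen_iff.2 ⟨d, fun s => (hd s).le, rfl⟩

theorem exists_pos_of_mem_interior_coneGen {a : Fin n → ℝ} (ha : a ∈ interior (coneGen n S)) :
    ∃ c : S → ℝ, (∀ s, 0 < c s) ∧ a = ∑ s, c s • realGen S s := by
  have hcont : Continuous fun ε : ℝ => a - ε • ∑ s, realGen S s := by fun_prop
  have h0 : Tendsto (fun ε : ℝ => a - ε • ∑ s, realGen S s) (𝓝[>] 0) (𝓝 a) := by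
    have := hcont.tendsto 0
    simp only [zero_smul, sub_zero] at this
    exact this.mono_left nhdsWithin_le_nhds
  obtain ⟨ε, hε, hpos⟩ := ((h0.eventually (mem_interior_iff_mem_nhds.1 ha)).and
    self_mem_nhdsWithin).exists
  obtain ⟨c, hc, h⟩ := mem_coneGen_iff.1 hε
  refine ⟨fun s => c s + ε, fun s => add_pos_of_nonneg_of_pos (hc s) hpos, ?_⟩
  simp only [add_smul, Finset.sum_add_distrib, ← h, ← Finset.smul_sum, sub_add_cancel]

theorem coneChar_apply_ne_zero {a : coneGen n S} (ha : a.1 ∈ interior (coneGen n S))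
    (p : conePoints n S) : coneChar a p ≠ 0 := by
  obtain ⟨c, hc, h⟩ := exists_pos_of_mem_interior_coneGen ha
  have hpos : ∀ s, 0 < (coneSection a).1 s := fun s =>
    pos_of_mem_nonnegToricSet (coneSection a).2 (fun s => (hc s).le)
      ((sum_coneSection_smul a).trans h) (hc s)
  rw [coneChar_apply, Complex.ofReal_ne_zero]
  exact (Finset.prod_pos fun s _ => Real.rpow_pos_of_pos (hpos s) _).ne'

theorem exists_eq_sub_of_conePoints
    (hS : Submodule.span ℝ ((fun v : Fin n → ℤ => fun i => (v i : ℝ)) '' ↑S) = ⊤)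
    (v : Fin n → ℤ) : ∃ p q : conePoints n S, v = (p : Fin n → ℤ) - q := by
  obtain ⟨c, hc⟩ := surjective_linearCombination_realGen hS fun i => (v i : ℝ)
  obtain ⟨N, hN⟩ := exists_nat_ge (∑ s, |c s|)
  let q : conePoints n S := N • ∑ s, genPoint s
  have hq : (fun i => (q.1 i : ℝ)) = (N : ℝ) • ∑ s, realGen S s := by
    ext i
    simp [q, realGen_def, genPoint]
  refine ⟨⟨v + q, mem_conePoints_iff.2 (mem_coneGen_iff.2 ⟨fun s => c s + N, fun s => ?_, ?_⟩)⟩,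
    q, by simp⟩
  · have h1 : |c s| ≤ ∑ s, |c s| :=
      Finset.single_le_sum (f := fun s => |c s|) (fun s _ => abs_nonneg _) (Finset.mem_univ s)
    simp only [Pi.zero_apply]
    linarith [neg_abs_le (c s)]
  · simp only [add_smul, Finset.sum_add_distrib, ← Finset.smul_sum, ← hq]
    rw [Fintype.linearCombination_apply] at hc
    rw [hc]
    ext i
    simp

/-- The product of a character of the torus with the nonnegative character attached to a point of
the interior of the cone. -/
noncomputable def torusOrbitMap (x : AddChar (Fin n → ℤ) Circle × interior (coneGen n S)) :
    AddChar (conePoints n S) ℂ where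
  toFun p := (x.1 (p : Fin n → ℤ) : ℂ) * coneChar ⟨x.2, interior_subset x.2.2⟩ p
  map_zero_eq_one' := by simp
  map_add_eq_mul' p q := by
    simp only [AddSubmonoid.coe_add, AddChar.map_add_eq_mul, Circle.coe_mul]
    ring

theorem torusOrbitMap_apply (x : AddChar (Fin n → ℤ) Circle × interior (coneGen n S))
    (p : conePoints n S) : torusOrbitMap x p =
      (x.1 (p : Fin n → ℤ) : ℂ) * coneChar ⟨x.2, interior_subset x.2.2⟩ p := rfl

theorem torusOrbitMap_ne_zero (x : AddChar (Fin n → ℤ) Circle × interior (coneGen n S))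
    (p : conePoints n S) : torusOrbitMap x p ≠ 0 :=
  mul_ne_zero (Circle.coe_ne_zero _) (coneChar_apply_ne_zero x.2.2 p)

theorem norm_torusOrbitMap (x : AddChar (Fin n → ℤ) Circle × interior (coneGen n S))
    (p : conePoints n S) :
    ‖torusOrbitMap x p‖ = ‖coneChar ⟨x.2, interior_subset x.2.2⟩ p‖ := by
  rw [torusOrbitMap_apply, norm_mul, Circle.norm_coe, one_mul]

theorem continuous_torusOrbitMap : Continuous (torusOrbitMap (S := S)) := by
  refine continuous_addChar_of_apply fun p => ?_
  refine .mul (continuous_induced_dom.comp ((continuous_addChar_apply _).comp continuous_fst)) ?_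
  exact (continuous_addChar_apply p).comp (continuous_coneChar.comp
    ((continuous_subtype_val.comp continuous_snd).subtype_mk _))

theorem momentumMap_mem_interior
    (hS : Submodule.span ℝ ((fun v : Fin n → ℤ => fun i => (v i : ℝ)) '' ↑S) = ⊤)
    {φ : AddChar (conePoints n S) ℂ} (hφ : ∀ p, φ p ≠ 0) :
    momentumMap φ ∈ interior (coneGen n S) :=
  sum_smul_mem_interior_coneGen hS fun s => norm_pos_iff.2 (hφ (genPoint s))

theorem isEmbedding_torusOrbitMap_and_range_eq
    (hS : Submodule.span ℝ ((fun v : Fin n → ℤ => fun i => (v i : ℝ)) '' ↑S) = ⊤) :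
    IsEmbedding (torusOrbitMap (S := S)) ∧
      Set.range (torusOrbitMap (S := S)) = {φ | ∀ p, φ p ≠ 0} := by
  choose p q hpq using exists_eq_sub_of_conePoints hS
  let polar : {φ : AddChar (conePoints n S) ℂ | ∀ p, φ p ≠ 0} →
      AddChar (Fin n → ℤ) Circle × interior (coneGen n S) := fun φ =>
    (angularPart p q hpq φ.1 φ.2, ⟨momentumMap φ.1, momentumMap_mem_interior hS φ.2⟩)
  have hpolar : Continuous polar := (continuous_angularPart p q hpq).prodMk
    ((continuous_momentumMap.comp continuous_subtype_val).subtype_mk _)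
  have hleft : Function.LeftInverse polar
      (Set.codRestrict torusOrbitMap {φ | ∀ p, φ p ≠ 0} torusOrbitMap_ne_zero) := by
    rintro ⟨lam, a⟩
    refine Prod.ext (angularPart_eq p q hpq (torusOrbitMap_ne_zero _) lam fun r => ?_) (Subtype.ext ?_)
    · rw [norm_torusOrbitMap, norm_coneChar_apply, torusOrbitMap_apply]
    · exact (momentumMap_congr (norm_torusOrbitMap _)).trans (momentumMap_coneChar _)
  refine ⟨IsEmbedding.subtypeVal.comp (hleft.isEmbedding hpolar
    (continuous_torusOrbitMap.subtype_mk _)), Set.Subset.antisymm ?_ fun φ hφ => ?_⟩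
  · rintro _ ⟨x, rfl⟩
    exact torusOrbitMap_ne_zero x
  · refine ⟨polar ⟨φ, hφ⟩, ?_⟩
    ext r
    rw [torusOrbitMap_apply, coneChar_momentumMap_apply]
    exact angularPart_mul_norm p q hpq hφ r

end Cone

/-- Let `S ⊂ ℤ^n` be a finite set spanning `ℝ^n`, `σ^∨` the cone generated by
`S`, and `P = σ^∨ ∩ ℤ^n`.  Then the affine toric variety `X = Hom(P, ℂ)` (monoid homomorphisms
with the topology of pointwise convergence) admits a momentum map `μ : X → ℝ^n` with image
`σ^∨`: `μ` is continuous, invariant under the action of `Λ = Hom(ℤ^n, circle)`, restricts to a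
homeomorphism of the positive locus `X_{≥0}` onto `σ^∨` with inverse `s₀`, and
`(λ, a) ↦ λ·s₀(a)` is a homeomorphism of `Λ × Int(σ^∨)` onto the big torus
`X° = {φ | φ(p) ≠ 0 for all p}`. -/
theorem affine_toric_momentum_map (n : ℕ) (S : Finset (Fin n → ℤ))
    (hS : Submodule.span ℝ ((fun v : Fin n → ℤ => fun i => (v i : ℝ)) '' ↑S) = ⊤) :
    ∃ μ : AddChar ↥(conePoints n S) ℂ → (Fin n → ℝ),
      Continuous μ ∧
      Set.range μ = coneGen n S ∧
      (∀ (lam : AddChar (Fin n → ℤ) Circle) (φ ψ : AddChar ↥(conePoints n S) ℂ),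
        (∀ p : ↥(conePoints n S), ψ p = (lam ↑p : ℂ) * φ p) → μ ψ = μ φ) ∧
      ∃ s₀ : ↥(coneGen n S) → AddChar ↥(conePoints n S) ℂ,
        Continuous s₀ ∧
        (∀ (a : ↥(coneGen n S)) (p : ↥(conePoints n S)),
          ∃ t : ℝ, 0 ≤ t ∧ s₀ a p = (t : ℂ)) ∧
        (∀ a : ↥(coneGen n S), μ (s₀ a) = ↑a) ∧
        (∀ φ : AddChar ↥(conePoints n S) ℂ,
          (∀ p : ↥(conePoints n S), ∃ t : ℝ, 0 ≤ t ∧ φ p = (t : ℂ)) →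
          ∃ a : ↥(coneGen n S), s₀ a = φ) ∧
        ∃ Ψ : (AddChar (Fin n → ℤ) Circle) × ↥(interior (coneGen n S)) →
            AddChar ↥(conePoints n S) ℂ,
          (∀ (lam : AddChar (Fin n → ℤ) Circle) (a : ↥(interior (coneGen n S)))
              (p : ↥(conePoints n S)),
            Ψ (lam, a) p = (lam ↑p : ℂ) * s₀ ⟨↑a, interior_subset a.2⟩ p) ∧
          Topology.IsEmbedding Ψ ∧
          Set.range Ψ = {φ : AddChar ↥(conePoints n S) ℂ |
            ∀ p : ↥(conePoints n S), φ p ≠ 0} := by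
  refine ⟨momentumMap, continuous_momentumMap, Set.Subset.antisymm ?_ fun a ha => ?_,
    fun lam φ ψ h => momentumMap_congr fun p => ?_, coneChar, continuous_coneChar,
    fun a p => ⟨_, prod_coneSection_nonneg a p, coneChar_apply a p⟩, momentumMap_coneChar,
    fun φ hφ => ⟨⟨momentumMap φ, momentumMap_mem φ⟩, ?_⟩, torusOrbitMap,
    fun lam a p => torusOrbitMap_apply (lam, a) p, isEmbedding_torusOrbitMap_and_range_eq hS⟩
  · rintro _ ⟨φ, rfl⟩
    exact momentumMap_mem φ
  · exact ⟨coneChar ⟨a, ha⟩, momentumMap_coneChar ⟨a, ha⟩⟩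
  · rw [h, norm_mul, Circle.norm_coe, one_mul]
  · ext p
    obtain ⟨t, ht, htφ⟩ := hφ p
    rw [coneChar_momentumMap_apply, htφ, Complex.norm_of_nonneg ht]
end

section
/- Let S ⊂ ℤ^n be a finite set whose ℝ-span is all of ℝ^n, σ^∨ the cone generated by S, and P = σ^∨ ∩ ℤ^n; assume (as follows from full-dimensionality) that P generates ℤ^n as a group. Let μ : Hom(P, ℂ) → ℝ^n be any momentum map as in the affine case, i.e. a continuous map with image σ^∨, invariant under the action of Hom(ℤ^n, circle), restricting to a homeomorphism of Hom(P, ℝ_{≥0}) onto σ^∨ with inverse s₀, and inducing a homeomorphism Hom(ℤ^n, circle) × Int(σ^∨) ≅ {φ : φ(P) ⊆ ℂ∖{0}}. Then the map σ^∨ × Hom(ℤ^n, circle) → Hom(P, ℝ_{≥0} × circle), (a, λ) ↦ (p ↦ (s₀(a)(p), λ(p))), is a homeomorphism, where Hom(P, ℝ_{≥0} × circle) denotes monoid homomorphisms into the product multiplicative monoid with the topology of pointwise convergence. Moreover, composing with the multiplication map ℝ_{≥0} × circle → ℂ carries (a, λ) to the point λ·s₀(a) of Hom(P, ℂ). -/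
theorem continuous_addChar_eval {A M : Type*} [AddMonoid A] [Monoid M] [TopologicalSpace M]
    (a : A) : Continuous fun χ : AddChar A M => χ a :=
  (continuous_apply a).comp continuous_induced_dom

theorem continuous_addChar_iff {X A M : Type*} [TopologicalSpace X] [AddMonoid A] [Monoid M]
    [TopologicalSpace M] {f : X → AddChar A M} :
    Continuous f ↔ ∀ a, Continuous fun x => f x a :=
  continuous_induced_rng.trans continuous_pi_iff

theorem AddSubmonoid.exists_eq_sub_of_closure_eq_top {A : Type*} [AddCommGroup A]
    {P : AddSubmonoid A} (hP : AddSubgroup.closure (P : Set A) = ⊤) (m : A) :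
    ∃ p q : P, m = p - q := by
  have hm : m ∈ AddSubgroup.closure (P : Set A) := hP ▸ AddSubgroup.mem_top m
  induction hm using AddSubgroup.closure_induction with
  | mem x hx => exact ⟨⟨x, hx⟩, 0, by simp⟩
  | zero => exact ⟨0, 0, by simp⟩
  | add x y _ _ hx hy =>
    obtain ⟨p, q, rfl⟩ := hx
    obtain ⟨p', q', rfl⟩ := hy
    exact ⟨p + p', q + q', by push_cast; abel⟩
  | neg x _ hx =>
    obtain ⟨p, q, rfl⟩ := hx
    exact ⟨q, p, by abel⟩

/-- Group-valued characters of a submonoid `P` generating `A` as a group extend to `A`,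
continuously for the topology of pointwise convergence. -/
theorem exists_continuous_addChar_extension {A G : Type*} [AddCommGroup A] [CommGroup G]
    [TopologicalSpace G] [IsTopologicalGroup G] {P : AddSubmonoid A}
    (hP : AddSubgroup.closure (P : Set A) = ⊤) :
    ∃ E : AddChar P G → AddChar A G, Continuous E ∧ ∀ χ (p : P), E χ p = χ p := by
  choose f g hfg using AddSubmonoid.exists_eq_sub_of_closure_eq_top hP
  have key (χ : AddChar P G) (m : A) (p q : P) (h : m = p - q) :
      χ (f m) / χ (g m) = χ p / χ q := by
    have h' : f m + q = p + g m := by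
      ext
      push_cast
      rw [← sub_eq_sub_iff_add_eq_add, ← hfg, h]
    rw [div_eq_div_iff_mul_eq_mul, ← AddChar.map_add_eq_mul, ← AddChar.map_add_eq_mul, h']
  refine ⟨fun χ =>
    { toFun := fun m => χ (f m) / χ (g m)
      map_zero_eq_one' := by rw [key χ 0 0 0 (by simp), div_self']
      map_add_eq_mul' := fun a b => by
        rw [key χ (a + b) (f a + f b) (g a + g b)
          (by push_cast; rw [add_sub_add_comm, ← hfg, ← hfg]),
          AddChar.map_add_eq_mul, AddChar.map_add_eq_mul, mul_div_mul_comm] }, ?_, ?_⟩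
  · exact continuous_addChar_iff.2 fun m =>
      (continuous_addChar_eval (f m)).div' (continuous_addChar_eval (g m))
  · intro χ p
    exact (key χ p p 0 (by simp)).trans (by simp)

theorem AddChar.eq_of_eqOn_of_closure_eq_top {A G : Type*} [AddCommGroup A] [CommGroup G]
    {P : AddSubmonoid A} (hP : AddSubgroup.closure (P : Set A) = ⊤) {χ ψ : AddChar A G}
    (h : ∀ p : P, χ p = ψ p) : χ = ψ := by
  ext m
  obtain ⟨p, q, rfl⟩ := AddSubmonoid.exists_eq_sub_of_closure_eq_top hP m
  rw [AddChar.map_sub_eq_div, AddChar.map_sub_eq_div, h, h]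

/-- For `P = σ^∨ ∩ ℤ^n` with `σ^∨` full-dimensional and `P` generating `ℤ^n`
as a group, and `μ` any momentum map for `X = Hom(P, ℂ)` with positive section `s₀`, the map
`σ^∨ × Hom(ℤ^n, circle) → Hom(P, ℝ_{≥0} × circle)`, `(a, λ) ↦ (p ↦ (s₀(a)(p), λ(p)))`, is a
homeomorphism onto the Kato–Nakayama space of `Spec ℂ[P]`; composing with the multiplication
map `ℝ_{≥0} × circle → ℂ` carries `(a, λ)` to the point `λ·s₀(a)` of `X`. -/
theorem KN_space_of_affine_toric (n : ℕ) (S : Finset (Fin n → ℤ))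
    (hS : Submodule.span ℝ ((fun v : Fin n → ℤ => fun i => (v i : ℝ)) '' ↑S) = ⊤)
    (hgen : AddSubgroup.closure ((conePoints n S : Set (Fin n → ℤ))) = ⊤)
    (μ : AddChar ↥(conePoints n S) ℂ → (Fin n → ℝ))
    (hcont : Continuous μ)
    (hrange : Set.range μ = coneGen n S)
    (hinv : ∀ (lam : AddChar (Fin n → ℤ) Circle) (φ ψ : AddChar ↥(conePoints n S) ℂ),
      (∀ p : ↥(conePoints n S), ψ p = (lam ↑p : ℂ) * φ p) → μ ψ = μ φ)
    (s₀ : ↥(coneGen n S) → AddChar ↥(conePoints n S) ℂ)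
    (hs₀cont : Continuous s₀)
    (hs₀pos : ∀ (a : ↥(coneGen n S)) (p : ↥(conePoints n S)),
      ∃ t : ℝ, 0 ≤ t ∧ s₀ a p = (t : ℂ))
    (hs₀sec : ∀ a : ↥(coneGen n S), μ (s₀ a) = ↑a)
    (hs₀surj : ∀ φ : AddChar ↥(conePoints n S) ℂ,
      (∀ p : ↥(conePoints n S), ∃ t : ℝ, 0 ≤ t ∧ φ p = (t : ℂ)) →
      ∃ a : ↥(coneGen n S), s₀ a = φ)
    (Ψ : (AddChar (Fin n → ℤ) Circle) × ↥(interior (coneGen n S)) →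
      AddChar ↥(conePoints n S) ℂ)
    (hΨ : ∀ (lam : AddChar (Fin n → ℤ) Circle) (a : ↥(interior (coneGen n S)))
        (p : ↥(conePoints n S)),
      Ψ (lam, a) p = (lam ↑p : ℂ) * s₀ ⟨↑a, interior_subset a.2⟩ p)
    (hΨemb : Topology.IsEmbedding Ψ)
    (hΨrange : Set.range Ψ = {φ : AddChar ↥(conePoints n S) ℂ |
      ∀ p : ↥(conePoints n S), φ p ≠ 0}) :
    ∃ Θ : ↥(coneGen n S) × (AddChar (Fin n → ℤ) Circle) →
        AddChar ↥(conePoints n S) (NNReal × Circle),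
      (∀ (a : ↥(coneGen n S)) (lam : AddChar (Fin n → ℤ) Circle) (p : ↥(conePoints n S)),
        (((Θ (a, lam) p).1 : ℝ) : ℂ) = s₀ a p ∧ (Θ (a, lam) p).2 = lam ↑p) ∧
      IsHomeomorph Θ ∧
      (∀ (a : ↥(coneGen n S)) (lam : AddChar (Fin n → ℤ) Circle) (p : ↥(conePoints n S)),
        (((Θ (a, lam) p).1 : ℝ) : ℂ) * ((Θ (a, lam) p).2 : ℂ) = (lam ↑p : ℂ) * s₀ a p) := by
  obtain ⟨E, hEcont, hE⟩ := exists_continuous_addChar_extension (G := Circle) hgen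
  have hr (a : ↥(coneGen n S)) (p : ↥(conePoints n S)) :
      (((s₀ a p).re.toNNReal : ℝ) : ℂ) = s₀ a p := by
    obtain ⟨t, ht, h⟩ := hs₀pos a p
    simp [h, ht]
  have hinj : Function.Injective fun x : NNReal => ((x : ℝ) : ℂ) :=
    Complex.ofReal_injective.comp NNReal.coe_injective
  let Θ : ↥(coneGen n S) × (AddChar (Fin n → ℤ) Circle) →
      AddChar ↥(conePoints n S) (NNReal × Circle) := fun x =>
    { toFun := fun p => ((s₀ x.1 p).re.toNNReal, x.2 p)
      map_zero_eq_one' := by simp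
      map_add_eq_mul' := fun p q => by
        refine Prod.ext (hinj ?_) ?_
        · simp only [Prod.mk_mul_mk, NNReal.coe_mul, Complex.ofReal_mul, hr]
          exact AddChar.map_add_eq_mul _ p q
        · simp [AddChar.map_add_eq_mul] }
  have hΘ₁ (a lam p) : (((Θ (a, lam) p).1 : ℝ) : ℂ) = s₀ a p := hr a p
  have hΘ₂ (a lam) (p : ↥(conePoints n S)) : (Θ (a, lam) p).2 = lam p := rfl
  let modulus (χ : AddChar ↥(conePoints n S) (NNReal × Circle)) :
      AddChar ↥(conePoints n S) ℂ :=
    (((Complex.ofRealHom.comp NNReal.toRealHom : NNReal →+* ℂ) : NNReal →* ℂ).comp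
      (MonoidHom.fst NNReal Circle)).compAddChar χ
  have hmodulus (χ p) : modulus χ p = (((χ p).1 : ℝ) : ℂ) := rfl
  let phase (χ : AddChar ↥(conePoints n S) (NNReal × Circle)) :
      AddChar ↥(conePoints n S) Circle := (MonoidHom.snd NNReal Circle).compAddChar χ
  have hphase (χ p) : phase χ p = (χ p).2 := rfl
  refine ⟨Θ, fun a lam p => ⟨hΘ₁ a lam p, hΘ₂ a lam p⟩,
    isHomeomorph_iff_exists_inverse.2 ⟨?_, fun χ =>
      (⟨μ (modulus χ), hrange ▸ Set.mem_range_self _⟩, E (phase χ)), ?_, ?_, ?_⟩,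
    fun a lam p => by rw [hΘ₁, hΘ₂, mul_comm]⟩
  · refine continuous_addChar_iff.2 fun p => .prodMk ?_ ?_
    · exact continuous_real_toNNReal.comp (Complex.continuous_re.comp
        ((continuous_addChar_eval p).comp (hs₀cont.comp continuous_fst)))
    · exact (continuous_addChar_eval (p : Fin n → ℤ)).comp continuous_snd
  · rintro ⟨a, lam⟩
    refine Prod.ext (Subtype.ext ?_) (AddChar.eq_of_eqOn_of_closure_eq_top hgen fun p => ?_)
    · have h : modulus (Θ (a, lam)) = s₀ a := by
        ext p
        rw [hmodulus, hΘ₁]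
      exact (congrArg μ h).trans (hs₀sec a)
    · rw [hE, hphase, hΘ₂]
  · intro χ
    obtain ⟨a, ha⟩ := hs₀surj (modulus χ) fun p => ⟨(χ p).1, NNReal.coe_nonneg _, rfl⟩
    have hμ : (⟨μ (modulus χ), hrange ▸ Set.mem_range_self _⟩ : ↥(coneGen n S)) = a :=
      Subtype.ext ((congrArg μ ha).symm.trans (hs₀sec a))
    ext1 p
    refine Prod.ext (hinj ?_) ?_
    · simp only [hΘ₁, hμ, ha, hmodulus]
    · rw [hΘ₂, hE, hphase]
  · refine .prodMk (.subtype_mk (hcont.comp (continuous_addChar_iff.2 fun p => ?_)) _)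
      (hEcont.comp (continuous_addChar_iff.2 fun p => ?_))
    · exact Complex.continuous_ofReal.comp (NNReal.continuous_coe.comp
        (continuous_fst.comp (continuous_addChar_eval p)))
    · exact continuous_snd.comp (continuous_addChar_eval p)
end

section
/- In the setting of the previous statement (P = σ^∨ ∩ ℤ^n for a full-dimensional rational polyhedral cone σ^∨ ⊆ ℝ^n, P generating ℤ^n as a group, and μ a momentum map with positive section s₀), consider the involution of Hom(P, ℝ_{≥0} × circle) given by postcomposition with (t, u) ↦ (t, u⁻¹) (complex conjugation on the unit circle). Under the homeomorphism σ^∨ × Hom(ℤ^n, circle) ≅ Hom(P, ℝ_{≥0} × circle), the fixed-point set of this involution corresponds exactly to σ^∨ × Hom(ℤ^n, {±1}); in particular, the fixed locus is homeomorphic to the disjoint union of 2^n copies of σ^∨, i.e. the real locus of the Kato–Nakayama space of an affine toric variety is canonically Ξ × Hom(M, ℤ/2ℤ). -/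
theorem Circle.inv_eq_self_iff (u : Circle) : u⁻¹ = u ↔ (u : ℂ) = 1 ∨ (u : ℂ) = -1 := by
  rw [inv_eq_iff_mul_eq_one, ← mul_self_eq_one_iff, ← Circle.coe_mul, Circle.coe_eq_one]

/-- An additive character with commutative values that is fixed by inversion on a generating set
is fixed by inversion everywhere. -/
theorem AddChar.inv_eq_self_of_closure_eq_top {A G : Type*} [AddGroup A] [CommGroup G]
    (lam : AddChar A G) {s : Set A} (hs : AddSubgroup.closure s = ⊤)
    (h : ∀ p ∈ s, (lam p)⁻¹ = lam p) (m : A) : (lam m)⁻¹ = lam m := by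
  have hm : m ∈ AddSubgroup.closure s := hs ▸ AddSubgroup.mem_top m
  induction hm using AddSubgroup.closure_induction with
  | mem p hp => exact h p hp
  | zero => simp
  | add a b _ _ ha hb => rw [AddChar.map_add_eq_mul, mul_inv, ha, hb]
  | neg a _ ha => rw [AddChar.map_neg_eq_inv, ha, ha]

instance addCharPointwiseTopology_t2Space (A M : Type*) [AddMonoid A] [Monoid M]
    [TopologicalSpace M] [T2Space M] : T2Space (AddChar A M) :=
  T2Space.of_injective_continuous (f := fun f : AddChar A M => (f : A → M))
    DFunLike.coe_injective continuous_induced_dom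

/-- The character `m ↦ ∏ i, z i ^ m i` of `ℤ^n`. -/
def AddChar.ofCoords {n : ℕ} {G : Type*} [CommGroup G] (z : Fin n → G) :
    AddChar (Fin n → ℤ) G where
  toFun m := ∏ i, z i ^ m i
  map_zero_eq_one' := by simp
  map_add_eq_mul' a b := by simp [zpow_add, Finset.prod_mul_distrib]

theorem AddChar.ofCoords_single {n : ℕ} {G : Type*} [CommGroup G] (z : Fin n → G) (i : Fin n) :
    AddChar.ofCoords z (Pi.single i 1) = z i := by
  change ∏ j, z j ^ (Pi.single i (1 : ℤ) : Fin n → ℤ) j = z i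
  rw [Finset.prod_eq_single i] <;> simp +contextual

theorem AddChar.ofCoords_apply_single {n : ℕ} {G : Type*} [CommGroup G]
    (lam : AddChar (Fin n → ℤ) G) :
    AddChar.ofCoords (fun i => lam (Pi.single i 1)) = lam := by
  ext m
  change ∏ i, lam (Pi.single i 1) ^ m i = lam m
  have hm : m = ∑ i, m i • (Pi.single i (1 : ℤ) : Fin n → ℤ) := by
    ext j
    simp [Finset.sum_apply, Pi.single_apply]
  have h : lam.toAddMonoidHom m = ∑ i, m i • lam.toAddMonoidHom (Pi.single i 1) := by
    conv_lhs => rw [hm]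
    simp only [map_sum, map_zsmul]
  exact h.symm

/-- The element `-1` of the unit circle for `false`, and `1` for `true`. -/
noncomputable def Circle.ofBool (b : Bool) : Circle :=
  if b then 1 else Circle.exp Real.pi

theorem Circle.coe_ofBool (b : Bool) : (Circle.ofBool b : ℂ) = if b then 1 else -1 := by
  cases b <;> simp [Circle.ofBool]

theorem Circle.ofBool_injective : Function.Injective Circle.ofBool := by
  intro a b h
  have h' := congrArg (fun u : Circle => (u : ℂ)) h
  simp only [Circle.coe_ofBool] at h'
  cases a <;> cases b <;> first | rfl | norm_num at h'

theorem Circle.inv_ofBool (b : Bool) : (Circle.ofBool b)⁻¹ = Circle.ofBool b := by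
  rw [Circle.inv_eq_self_iff, Circle.coe_ofBool]
  cases b <;> simp

theorem Circle.exists_ofBool_eq {u : Circle} (h : u⁻¹ = u) : ∃ b, Circle.ofBool b = u := by
  rcases (Circle.inv_eq_self_iff u).1 h with h | h
  · exact ⟨true, Circle.ext (by simp [Circle.coe_ofBool, h])⟩
  · exact ⟨false, Circle.ext (by simp [Circle.coe_ofBool, h])⟩

/-- Sign vectors in `{±1}^n` are the same as circle characters of `ℤ^n` fixed by inversion. -/
noncomputable def boolHomeomorphRealChar (n : ℕ) :
    (Fin n → Bool) ≃ₜ {lam : AddChar (Fin n → ℤ) Circle // ∀ m, (lam m)⁻¹ = lam m} :=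
  let f (b : Fin n → Bool) : {lam : AddChar (Fin n → ℤ) Circle // ∀ m, (lam m)⁻¹ = lam m} :=
    ⟨AddChar.ofCoords fun i => Circle.ofBool (b i), fun m => by
      change (∏ i, Circle.ofBool (b i) ^ m i)⁻¹ = ∏ i, Circle.ofBool (b i) ^ m i
      simp_rw [← Finset.prod_inv_distrib, ← inv_zpow, Circle.inv_ofBool]⟩
  have hf : Function.Bijective f := by
    refine ⟨fun a b h => funext fun i => Circle.ofBool_injective ?_, fun ⟨lam, h⟩ => ?_⟩
    · have h' := DFunLike.congr_fun (congrArg Subtype.val h) (Pi.single i 1)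
      simpa only [f, AddChar.ofCoords_single] using h'
    · choose b hb using fun i => Circle.exists_ofBool_eq (h (Pi.single i 1))
      refine ⟨b, Subtype.ext ?_⟩
      simp only [f, hb, AddChar.ofCoords_apply_single]
  Continuous.homeoOfEquivCompactToT2 (f := Equiv.ofBijective f hf) continuous_of_discreteTopology

/-- A condition on the second coordinate cuts out a product. -/
def Homeomorph.subtypeSnd {X Y : Type*} [TopologicalSpace X] [TopologicalSpace Y]
    (q : Y → Prop) : {x : X × Y // q x.2} ≃ₜ X × {y // q y} where
  toFun x := (x.1.1, ⟨x.1.2, x.2⟩)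
  invFun x := ⟨(x.1, x.2.1), x.2.2⟩
  left_inv _ := rfl
  right_inv _ := rfl
  continuous_toFun := by fun_prop
  continuous_invFun := by fun_prop

/-- In the setting of the Kato–Nakayama space of an affine toric variety
(`P = σ^∨ ∩ ℤ^n`, `P` generating `ℤ^n`, `Θ` the canonical homeomorphism
`σ^∨ × Hom(ℤ^n, circle) ≅ Hom(P, ℝ_{≥0} × circle)`), consider the involution of
`Hom(P, ℝ_{≥0} × circle)` given by postcomposing with `(t, u) ↦ (t, u⁻¹)` (complex conjugation
on the circle).  Its fixed-point set corresponds under `Θ` exactly to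
`σ^∨ × Hom(ℤ^n, {±1})`; in particular the fixed locus (the real locus of the Kato–Nakayama
space) is homeomorphic to a disjoint union of `2^n` copies of `σ^∨`. -/
theorem real_locus_KN_affine_toric (n : ℕ) (S : Finset (Fin n → ℤ))
    (hS : Submodule.span ℝ ((fun v : Fin n → ℤ => fun i => (v i : ℝ)) '' ↑S) = ⊤)
    (hgen : AddSubgroup.closure ((conePoints n S : Set (Fin n → ℤ))) = ⊤)
    (μ : AddChar ↥(conePoints n S) ℂ → (Fin n → ℝ))
    (hcont : Continuous μ)
    (hrange : Set.range μ = coneGen n S)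
    (hinv : ∀ (lam : AddChar (Fin n → ℤ) Circle) (φ ψ : AddChar ↥(conePoints n S) ℂ),
      (∀ p : ↥(conePoints n S), ψ p = (lam ↑p : ℂ) * φ p) → μ ψ = μ φ)
    (s₀ : ↥(coneGen n S) → AddChar ↥(conePoints n S) ℂ)
    (hs₀cont : Continuous s₀)
    (hs₀pos : ∀ (a : ↥(coneGen n S)) (p : ↥(conePoints n S)),
      ∃ t : ℝ, 0 ≤ t ∧ s₀ a p = (t : ℂ))
    (hs₀sec : ∀ a : ↥(coneGen n S), μ (s₀ a) = ↑a)
    (hs₀surj : ∀ φ : AddChar ↥(conePoints n S) ℂ,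
      (∀ p : ↥(conePoints n S), ∃ t : ℝ, 0 ≤ t ∧ φ p = (t : ℂ)) →
      ∃ a : ↥(coneGen n S), s₀ a = φ)
    (Θ : ↥(coneGen n S) × (AddChar (Fin n → ℤ) Circle) →
      AddChar ↥(conePoints n S) (NNReal × Circle))
    (hΘ : ∀ (a : ↥(coneGen n S)) (lam : AddChar (Fin n → ℤ) Circle) (p : ↥(conePoints n S)),
      (((Θ (a, lam) p).1 : ℝ) : ℂ) = s₀ a p ∧ (Θ (a, lam) p).2 = lam ↑p)
    (hΘhomeo : IsHomeomorph Θ) :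
    (∀ (a : ↥(coneGen n S)) (lam : AddChar (Fin n → ℤ) Circle),
      (∀ p : ↥(conePoints n S), ((Θ (a, lam) p).2)⁻¹ = (Θ (a, lam) p).2) ↔
      (∀ m : Fin n → ℤ, (lam m : ℂ) = 1 ∨ (lam m : ℂ) = -1)) ∧
    Nonempty
      ((↥{y : AddChar ↥(conePoints n S) (NNReal × Circle) |
          ∀ p : ↥(conePoints n S), ((y p).2)⁻¹ = (y p).2}) ≃ₜ
        (↥(coneGen n S) × (Fin n → Bool))) := by
  have key (a : ↥(coneGen n S)) (lam : AddChar (Fin n → ℤ) Circle) :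
      (∀ p : ↥(conePoints n S), ((Θ (a, lam) p).2)⁻¹ = (Θ (a, lam) p).2) ↔
        ∀ m : Fin n → ℤ, (lam m)⁻¹ = lam m := by
    simp only [fun p => (hΘ a lam p).2]
    exact ⟨fun h => lam.inv_eq_self_of_closure_eq_top hgen fun p hp => h ⟨p, hp⟩,
      fun h p => h p⟩
  refine ⟨fun a lam => ?_, ⟨?_⟩⟩
  · simp only [key, ← Circle.inv_eq_self_iff]
  · exact (((hΘhomeo.homeomorph Θ).subtype
      (p := fun x => ∀ m : Fin n → ℤ, (x.2 m)⁻¹ = x.2 m)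
      (q := fun y => ∀ p : ↥(conePoints n S), ((y p).2)⁻¹ = (y p).2)
      fun x => (key x.1 x.2).symm).symm.trans (Homeomorph.subtypeSnd fun lam : AddChar (Fin n → ℤ) Circle =>
          ∀ m : Fin n → ℤ, (lam m)⁻¹ = lam m)).trans
        ((Homeomorph.refl _).prodCongr (boolHomeomorphRealChar n).symm)
end

section
/- Let G be an abelian group (written multiplicatively), ι : G → G a group homomorphism with ι ∘ ι = id, and H ≤ G a subgroup such that ι(g)·g⁻¹ ∈ H for all g ∈ G (so ι induces the identity on G/H and preserves H). Let χ : H → circle be a group homomorphism with χ(ι(h)) = χ(h)⁻¹ for all h ∈ H. Set T = {θ : G → circle a group homomorphism : θ|_H = χ and θ(ι(g)) = θ(g)⁻¹ for all g ∈ G}. Then the group Hom(G/H, {±1}) acts on T by (τ·θ)(g) = τ(gH)·θ(g), and this action is free and transitive; in particular, if T is nonempty and G/H is free abelian of rank r, then T has exactly 2^r elements. -/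
/-- The set `T` of characters `θ : G →* circle` restricting to `χ` on `H` and satisfying
`θ(ι g) = θ(g)⁻¹` for all `g`. -/
def RealCharSet {G : Type*} [CommGroup G] (ι : G →* G) (H : Subgroup G)
    (χ : ↥H →* Circle) : Set (G →* Circle) :=
  {θ | (∀ h : ↥H, θ ↑h = χ h) ∧ ∀ g : G, θ (ι g) = (θ g)⁻¹}

/-- The characters of `Q` with values in `{1, -1}`. -/
abbrev SignCharacter (Q : Type*) [CommGroup Q] :=
  {τ : Q →* Circle // ∀ x, (τ x : ℂ) = 1 ∨ (τ x : ℂ) = -1}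

theorem Circle.coe_eq_one_or_neg_one_iff (z : Circle) :
    ((z : ℂ) = 1 ∨ (z : ℂ) = -1) ↔ z ^ 2 = 1 := by
  rw [← sq_eq_one_iff, ← Circle.coe_pow, Circle.coe_eq_one]

theorem Circle.card_sq_eq_one : Nat.card {z : Circle // z ^ 2 = 1} = 2 := by
  refine Nat.card_eq_two_iff.2 ⟨⟨1, one_pow 2⟩, ⟨Circle.exp Real.pi, ?_⟩, ?_, ?_⟩
  · rw [← Circle.coe_eq_one_or_neg_one_iff]
    simp [Circle.coe_exp]
  · intro h
    have h' := congrArg (fun z : {z : Circle // z ^ 2 = 1} ↦ ((z : Circle) : ℂ)) h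
    norm_num [Circle.coe_exp] at h'
  · refine Set.eq_univ_of_forall fun ⟨z, hz⟩ ↦ ?_
    rcases (Circle.coe_eq_one_or_neg_one_iff z).2 hz with h | h
    · exact Or.inl (Subtype.ext (Circle.ext (by simpa using h)))
    · exact Or.inr (Subtype.ext (Circle.ext (by simpa [Circle.coe_exp] using h)))

/-- Homomorphisms out of a free abelian group of finite rank are determined by arbitrary values
on the standard basis. -/
noncomputable def homEquivOfFree {Q A : Type*} [CommGroup Q] [CommGroup A] {r : ℕ}
    (e : Q ≃* Multiplicative (Fin r → ℤ)) : (Q →* A) ≃* (Fin r → A) :=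
  MulEquiv.ofBijective
    (MonoidHom.mk' (fun τ i ↦ τ (e.symm (.ofAdd (Pi.single i 1)))) fun _ _ ↦ rfl) <| by
    constructor
    · intro σ τ h
      have h' : (σ.comp e.symm.toMonoidHom).toAdditiveRight.toIntLinearMap =
          (τ.comp e.symm.toMonoidHom).toAdditiveRight.toIntLinearMap :=
        (Pi.basisFun ℤ (Fin r)).ext fun i ↦ by
          rw [Pi.basisFun_apply]
          exact congrArg Additive.ofMul (congrFun h i)
      ext x
      simpa using LinearMap.congr_fun h' (e x).toAdd
    · intro f
      refine ⟨(AddMonoidHom.toMultiplicativeLeft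
        ((Pi.basisFun ℤ (Fin r)).constr ℤ fun i ↦ Additive.ofMul (f i)).toAddMonoidHom).comp
          e.toMonoidHom, ?_⟩
      funext i
      simp

theorem SignCharacter.card_of_free {Q : Type*} [CommGroup Q] {r : ℕ}
    (e : Q ≃* Multiplicative (Fin r → ℤ)) : Nat.card (SignCharacter Q) = 2 ^ r := by
  have E : SignCharacter Q ≃ {f : Fin r → Circle // ∀ i, f i ^ 2 = 1} :=
    (homEquivOfFree e).toEquiv.subtypeEquiv fun τ ↦ by
      simp_rw [Circle.coe_eq_one_or_neg_one_iff]
      trans τ ^ 2 = 1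
      · simp [MonoidHom.ext_iff]
      · rw [← (homEquivOfFree e).map_eq_one_iff, map_pow, funext_iff]
        rfl
  rw [Nat.card_congr (E.trans (Equiv.subtypePiEquivPi (p := fun _ z ↦ z ^ 2 = 1))),
    Nat.card_pi]
  simp [Circle.card_sq_eq_one]

namespace RealCharSet

variable {G : Type*} [CommGroup G] {ι : G →* G} {H : Subgroup G} {χ : ↥H →* Circle}

theorem sign_mul_mem (hιH : ∀ g : G, ι g * g⁻¹ ∈ H) {τ : G ⧸ H →* Circle}
    (hτ : ∀ x, (τ x : ℂ) = 1 ∨ (τ x : ℂ) = -1) {θ : G →* Circle}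
    (hθ : θ ∈ RealCharSet ι H χ) :
    τ.comp (QuotientGroup.mk' H) * θ ∈ RealCharSet ι H χ := by
  refine ⟨fun h ↦ ?_, fun g ↦ ?_⟩
  · have : (QuotientGroup.mk' H) (h : G) = 1 := (QuotientGroup.eq_one_iff _).2 h.2
    rw [MonoidHom.mul_apply, MonoidHom.comp_apply, this, map_one, one_mul, hθ.1]
  · have hg : QuotientGroup.mk' H (ι g) = QuotientGroup.mk' H g := by
      rw [← div_eq_one, ← map_div, div_eq_mul_inv]
      exact (QuotientGroup.eq_one_iff _).2 (hιH g)
    have hsq := (Circle.coe_eq_one_or_neg_one_iff _).1 (hτ (QuotientGroup.mk' H g))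
    rw [sq, ← eq_inv_iff_mul_eq_one] at hsq
    rw [MonoidHom.mul_apply, MonoidHom.mul_apply, MonoidHom.comp_apply, MonoidHom.comp_apply,
      hg, hθ.2, mul_inv, ← hsq]

theorem existsUnique_sign_mul_eq (hιH : ∀ g : G, ι g * g⁻¹ ∈ H) {θ θ' : G →* Circle}
    (hθ : θ ∈ RealCharSet ι H χ) (hθ' : θ' ∈ RealCharSet ι H χ) :
    ∃! τ : SignCharacter (G ⧸ H),
      (τ : G ⧸ H →* Circle).comp (QuotientGroup.mk' H) * θ = θ' := by
  have hker : H ≤ (θ' / θ).ker := fun h hh ↦ by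
    rw [MonoidHom.mem_ker, MonoidHom.div_apply, hθ.1 ⟨h, hh⟩, hθ'.1 ⟨h, hh⟩, div_self']
  have hsq (g : G) : (θ' / θ) g ^ 2 = 1 := by
    have h₁ : (θ' / θ) (ι g) = ((θ' / θ) g)⁻¹ := by
      simp only [MonoidHom.div_apply, hθ.2, hθ'.2, inv_div_inv, inv_div]
    have h₂ := MonoidHom.mem_ker.1 (hker (hιH g))
    rw [map_mul, map_inv, h₁, ← sq, inv_pow, inv_eq_one] at h₂
    exact h₂
  refine ⟨⟨QuotientGroup.lift H (θ' / θ) hker, fun x ↦ ?_⟩, ?_, fun τ hτ ↦ ?_⟩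
  · obtain ⟨g, rfl⟩ := QuotientGroup.mk'_surjective H x
    exact (Circle.coe_eq_one_or_neg_one_iff _).2 (hsq g)
  · ext1 g
    exact div_mul_cancel (θ' g) (θ g)
  · refine Subtype.ext (QuotientGroup.monoidHom_ext H ?_)
    exact eq_div_of_mul_eq' hτ

theorem card_eq_card_signCharacter (hιH : ∀ g : G, ι g * g⁻¹ ∈ H)
    (hne : (RealCharSet ι H χ).Nonempty) :
    Nat.card (RealCharSet ι H χ) = Nat.card (SignCharacter (G ⧸ H)) := by
  obtain ⟨θ, hθ⟩ := hne
  symm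
  refine Nat.card_congr (Equiv.ofBijective
    (fun τ ↦ ⟨τ.1.comp (QuotientGroup.mk' H) * θ, sign_mul_mem hιH τ.2 hθ⟩) ?_)
  refine (Function.bijective_iff_existsUnique _).2 fun ⟨θ', hθ'⟩ ↦ ?_
  simpa only [Subtype.mk.injEq] using existsUnique_sign_mul_eq hιH hθ hθ'

end RealCharSet

/-- Let `G` be an abelian group, `ι : G → G` a homomorphism with `ι ∘ ι = id`,
`H ≤ G` a subgroup with `ι(g)·g⁻¹ ∈ H` for all `g` (so `ι` induces the identity on `G/H` and
preserves `H`), and `χ : H → circle` a homomorphism with `χ(ι h) = χ(h)⁻¹`.  Then the group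
`Hom(G/H, {±1})` acts freely and transitively on
`T = {θ : G →* circle | θ|_H = χ, θ(ι g) = θ(g)⁻¹}` by `(τ·θ)(g) = τ(gH)·θ(g)`;
in particular if `T ≠ ∅` and `G/H` is free abelian of rank `r` then `|T| = 2^r`. -/
theorem real_fibre_torsor (G : Type*) [CommGroup G] (ι : G →* G)
    (hinv : ∀ g, ι (ι g) = g) (H : Subgroup G)
    (hιH : ∀ g : G, ι g * g⁻¹ ∈ H) (hH : ∀ h ∈ H, ι h ∈ H)
    (χ : ↥H →* Circle) (hχ : ∀ h : ↥H, χ ⟨ι ↑h, hH ↑h h.2⟩ = (χ h)⁻¹) :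
    (∀ τ : (G ⧸ H) →* Circle, (∀ x, (τ x : ℂ) = 1 ∨ (τ x : ℂ) = -1) →
      ∀ θ ∈ RealCharSet ι H χ, τ.comp (QuotientGroup.mk' H) * θ ∈ RealCharSet ι H χ) ∧
    (∀ θ ∈ RealCharSet ι H χ, ∀ θ' ∈ RealCharSet ι H χ,
      ∃! τ : {τ : (G ⧸ H) →* Circle // ∀ x, (τ x : ℂ) = 1 ∨ (τ x : ℂ) = -1},
        (τ : (G ⧸ H) →* Circle).comp (QuotientGroup.mk' H) * θ = θ') ∧
    (∀ r : ℕ, (RealCharSet ι H χ).Nonempty →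
      Nonempty ((G ⧸ H) ≃* Multiplicative (Fin r → ℤ)) →
      Nat.card (RealCharSet ι H χ) = 2 ^ r) := by
  exact ⟨fun _ hτ _ hθ ↦ RealCharSet.sign_mul_mem hιH hτ hθ,
    fun _ hθ _ hθ' ↦ RealCharSet.existsUnique_sign_mul_eq hιH hθ hθ',
    fun _ hne ⟨e⟩ ↦ (RealCharSet.card_eq_card_signCharacter hιH hne).trans
      (SignCharacter.card_of_free e)⟩
end

section
/- Let G be an abelian group (written multiplicatively), ι : G → G an automorphism with ι ∘ ι = id, and G' ≤ G a subgroup such that G is the internal direct product of G' and ι(G') (i.e. G' ∩ ι(G') = {1} and G'·ι(G') = G). Then the restriction map θ ↦ θ|_{G'} is a bijection from the set {θ : G → circle a group homomorphism : θ(ι(g)) = θ(g)⁻¹ for all g ∈ G} onto the set Hom(G', circle) of all group homomorphisms G' → circle. In particular, for G = ℤ² with ι(a, b) = (b, a), the set of such θ is in bijection with circle. -/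
/-- If `K` and `L` are complementary subgroups of a commutative group, multiplication
`K × L → G` is bijective. -/
theorem Subgroup.bijective_coprod_subtype {G : Type*} [CommGroup G] {K L : Subgroup G}
    (hdisj : K ⊓ L = ⊥) (hspan : K ⊔ L = ⊤) :
    Function.Bijective (K.subtype.coprod L.subtype) := by
  have hKL : K.IsComplement' L :=
    Subgroup.isComplement'_of_disjoint_and_mul_eq_univ (disjoint_iff.mpr hdisj) (by
      rw [← Subgroup.mul_normal, hspan, Subgroup.coe_top])
  exact hKL

/-- Restriction to `K` is a bijection from the homomorphisms `G →* A` that an involution `ι`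
inverts onto all homomorphisms `K →* A`, when `K` and `ι K` are complementary. -/
theorem MonoidHom.bijOn_restrict_of_swap {G A : Type*} [CommGroup G] [CommGroup A] (ι : G ≃* G)
    (hinv : ∀ g, ι (ι g) = g) (K : Subgroup G)
    (hdisj : K ⊓ K.map ι.toMonoidHom = ⊥) (hspan : K ⊔ K.map ι.toMonoidHom = ⊤) :
    Set.BijOn (fun θ : G →* A => θ.comp K.subtype)
      {θ : G →* A | ∀ g : G, θ (ι g) = (θ g)⁻¹} Set.univ := by
  have hbij := Subgroup.bijective_coprod_subtype hdisj hspan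
  have hdecomp (g : G) : ∃ a b : K, (a : G) * ι b = g := by
    obtain ⟨⟨a, ⟨_, b, hb, rfl⟩⟩, rfl⟩ := hbij.surjective g
    exact ⟨a, ⟨b, hb⟩, rfl⟩
  refine ⟨fun _ _ => Set.mem_univ _, ?_, ?_⟩
  · intro θ hθ ψ hψ h
    have hK (a : K) : θ a = ψ a := DFunLike.congr_fun h a
    ext g
    obtain ⟨a, b, rfl⟩ := hdecomp g
    rw [map_mul, map_mul, hθ, hψ, hK, hK]
  · intro φ _
    let e := MulEquiv.ofBijective _ hbij
    let ιK := ι.subgroupMap K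
    let θ : G →* A := (φ.coprod (φ⁻¹.comp ιK.symm.toMonoidHom)).comp e.symm.toMonoidHom
    have hθ (a b : K) : θ (a * ι b) = φ a * (φ b)⁻¹ := by
      have he : e.symm (a * ι b) = (a, ιK b) := e.symm_apply_eq.mpr rfl
      change φ (e.symm (a * ι b)).1 * (φ (ιK.symm (e.symm (a * ι b)).2))⁻¹ = _
      rw [he, MulEquiv.symm_apply_apply]
    refine ⟨θ, fun g => ?_, ?_⟩
    · obtain ⟨a, b, rfl⟩ := hdecomp g
      rw [map_mul, hinv, mul_comm, hθ, hθ, mul_inv, inv_inv, mul_comm]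
    · ext a
      simpa using hθ a 1

/-- Homomorphisms `ℤ² → A` inverted by the coordinate swap correspond to elements of `A`, by
evaluation at `(1, 0)`. -/
def intProdSwapHomEquiv (A : Type*) [CommGroup A] :
    {θ : Multiplicative (ℤ × ℤ) →* A //
      ∀ a b : ℤ, θ (Multiplicative.ofAdd (b, a)) = (θ (Multiplicative.ofAdd (a, b)))⁻¹} ≃ A where
  toFun θ := θ.1 (Multiplicative.ofAdd (1, 0))
  invFun z :=
    ⟨(zpowersHom A z).comp (AddMonoidHom.fst ℤ ℤ - AddMonoidHom.snd ℤ ℤ).toMultiplicative, by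
      intro a b
      simp [zpowersHom_apply, ← zpow_neg]⟩
  left_inv := by
    rintro ⟨θ, hθ⟩
    refine Subtype.ext (MonoidHom.ext fun p => ?_)
    obtain ⟨⟨a, b⟩, rfl⟩ := Multiplicative.ofAdd.surjective p
    have hp : Multiplicative.ofAdd ((a, b) : ℤ × ℤ) =
        Multiplicative.ofAdd (1, 0) ^ a * Multiplicative.ofAdd (0, 1) ^ b := by
      rw [← ofAdd_zsmul, ← ofAdd_zsmul, ← ofAdd_add]
      simp
    change θ (Multiplicative.ofAdd (1, 0)) ^ (a - b) = θ (Multiplicative.ofAdd (a, b))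
    rw [hp, map_mul, map_zpow, map_zpow, hθ 1 0, zpow_sub, inv_zpow]
  right_inv z := by simp [zpowersHom_apply]


/-- Let `G` be an abelian group, `ι` an automorphism of `G` with `ι ∘ ι = id`,
and `G' ≤ G` a subgroup with `G' ∩ ι(G') = 1` and `G'·ι(G') = G`.  Then restriction
`θ ↦ θ|_{G'}` is a bijection from `{θ : G →* circle | θ(ι g) = θ(g)⁻¹ for all g}` onto the set of
all homomorphisms `G' →* circle`.  In particular, for `G = ℤ²` with `ι(a,b) = (b,a)` the set of
such `θ` is in bijection with the circle. -/
theorem real_fibre_swap_branches (G : Type*) [CommGroup G] (ι : G ≃* G)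
    (hinv : ∀ g, ι (ι g) = g) (G' : Subgroup G)
    (hdisj : G' ⊓ G'.map ι.toMonoidHom = ⊥) (hspan : G' ⊔ G'.map ι.toMonoidHom = ⊤) :
    Set.BijOn (fun θ : G →* Circle => θ.comp G'.subtype)
      {θ : G →* Circle | ∀ g : G, θ (ι g) = (θ g)⁻¹} Set.univ ∧
    Nonempty ({θ : Multiplicative (ℤ × ℤ) →* Circle //
        ∀ a b : ℤ, θ (Multiplicative.ofAdd (b, a)) = (θ (Multiplicative.ofAdd (a, b)))⁻¹}
      ≃ Circle) := by
  exact ⟨MonoidHom.bijOn_restrict_of_swap ι hinv G' hdisj hspan, ⟨intProdSwapHomEquiv Circle⟩⟩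
end
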